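/- arXiv:1105.5886 — 2 statements merged into one kernel-verified Lean document; each statement's English description precedes it below -/
import Mathlib

section
/- Let N ≥ 7 and let Ω ⊂ ℝ^N be a smooth bounded domain with 0 ∈ ∂Ω. Let c satisfy N − 1 < c ≤ μ(Ω) and let p ≥ p_{S_+^{N−1}} := 1 + 2/((N−2)/2 − √(N²/4 − c)). If u ∈ L^p_loc(Ω) is nonnegative, c|x|^{−2}u ∈ L¹_loc(Ω), and ∫ u(−Δφ − c|x|^{−2}φ) dx ≥ ∫ u^p φ dx for every nonnegative φ ∈ C_c^∞(Ω), then u ≡ 0 almost everywhere in Ω. (For N ≥ 7 the interval (N−1, μ(Ω)] is nonempty, since (N−2)²/4 < μ(Ω) ≤ N²/4 for every smooth bounded domain with 0 ∈ ∂Ω.) -/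
open MeasureTheory Metric Filter
open scoped Topology ENNReal NNReal RealInnerProductSpace

noncomputable section

/-- `ℝ^N` as a Euclidean space. -/
abbrev Euc (N : ℕ) : Type := EuclideanSpace ℝ (Fin N)

/-- `φ ∈ C_c^∞(Ω)`: smooth functions with compact support contained in `Ω`. -/
def IsTestFun {N : ℕ} (Ω : Set (Euc N)) (φ : Euc N → ℝ) : Prop :=
  ContDiff ℝ (⊤ : ℕ∞) φ ∧ HasCompactSupport φ ∧ tsupport φ ⊆ Ω

/-- The classical Laplacian of `φ` at `x`: the sum of the pure second partial derivatives. -/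
def lap {N : ℕ} (φ : Euc N → ℝ) (x : Euc N) : ℝ :=
  ∑ i : Fin N, iteratedFDeriv ℝ 2 φ x ![EuclideanSpace.single i 1, EuclideanSpace.single i 1]

/-- The best constant `μ(Ω)` in the Hardy inequality on `Ω` with the weight `|x|⁻²`. -/
def hardyConst {N : ℕ} (Ω : Set (Euc N)) : ℝ :=
  sInf {t : ℝ | ∃ φ : Euc N → ℝ, IsTestFun Ω φ ∧ φ ≠ 0 ∧
    t = (∫ x in Ω, ‖gradient φ x‖ ^ 2) / (∫ x in Ω, ‖x‖ ^ (-2 : ℝ) * φ x ^ 2)}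

/-- A smooth domain of `ℝ^N`: a nonempty open connected set whose boundary is, near each of
its points, the zero set of a smooth function with non-vanishing differential, the domain
being the corresponding sublevel set. -/
def IsSmoothDomain {N : ℕ} (Ω : Set (Euc N)) : Prop :=
  IsOpen Ω ∧ Ω.Nonempty ∧ IsConnected Ω ∧
    ∀ x ∈ frontier Ω, ∃ (U : Set (Euc N)) (f : Euc N → ℝ),
      IsOpen U ∧ x ∈ U ∧ ContDiff ℝ (⊤ : ℕ∞) f ∧ (∀ y ∈ U, fderiv ℝ f y ≠ 0) ∧
      Ω ∩ U = {y ∈ U | f y < 0} ∧ frontier Ω ∩ U = {y ∈ U | f y = 0}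

/-- Smooth convex regularisation of the positive part. -/
def Theta (w : ℝ) : ℝ := ∫ x in (-1 : ℝ)..w, Real.smoothTransition (x + 1)

lemma Theta_hasDerivAt (w : ℝ) : HasDerivAt Theta (Real.smoothTransition (w + 1)) w := by
  have hc : Continuous fun x : ℝ => Real.smoothTransition (x + 1) :=
    Real.smoothTransition.continuous.comp (by fun_prop)
  exact intervalIntegral.integral_hasDerivAt_right (hc.intervalIntegrable _ _)
    (hc.stronglyMeasurableAtFilter _ _) hc.continuousAt

lemma Theta_contDiff : ContDiff ℝ (⊤ : ℕ∞) Theta := by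
  have h1 : deriv Theta = fun w => Real.smoothTransition (w + 1) :=
    funext fun w => (Theta_hasDerivAt w).deriv
  refine contDiff_infty_iff_deriv.2 ⟨fun w => (Theta_hasDerivAt w).differentiableAt, ?_⟩
  rw [h1]
  exact Real.smoothTransition.contDiff.comp (by fun_prop)

lemma Theta_eq_zero {w : ℝ} (h : w ≤ -1) : Theta w = 0 := by
  unfold Theta
  rw [intervalIntegral.integral_congr (g := fun _ => (0 : ℝ))]
  · simp
  · intro x hx
    rw [Set.uIcc_of_ge h] at hx
    exact Real.smoothTransition.zero_of_nonpos (by linarith [hx.2])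

lemma Theta_mono : Monotone Theta := by
  apply monotone_of_deriv_nonneg (fun w => (Theta_hasDerivAt w).differentiableAt)
  intro w
  rw [(Theta_hasDerivAt w).deriv]
  exact Real.smoothTransition.nonneg _

lemma Theta_nonneg (w : ℝ) : 0 ≤ Theta w := by
  rcases le_total w (-1) with h | h
  · rw [Theta_eq_zero h]
  · have := Theta_mono h
    rwa [Theta_eq_zero le_rfl] at this

lemma Theta_sub (w : ℝ) (h : 0 ≤ w) : Theta w = Theta 0 + w := by
  have hc : Continuous fun x : ℝ => Real.smoothTransition (x + 1) :=
    Real.smoothTransition.continuous.comp (by fun_prop)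
  unfold Theta
  rw [← intervalIntegral.integral_add_adjacent_intervals (b := 0) (hc.intervalIntegrable _ _)
    (hc.intervalIntegrable _ _)]
  congr 1
  rw [intervalIntegral.integral_congr (g := fun _ => (1 : ℝ))]
  · simp
  · intro x hx
    rw [Set.uIcc_of_le h] at hx
    exact Real.smoothTransition.one_of_one_le (by linarith [hx.1])

lemma Theta_zero_le : Theta 0 ≤ 1 := by
  have hc : Continuous fun x : ℝ => Real.smoothTransition (x + 1) :=
    Real.smoothTransition.continuous.comp (by fun_prop)
  have : Theta 0 ≤ ∫ x in (-1 : ℝ)..0, (1 : ℝ) := by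
    apply intervalIntegral.integral_mono_on (by norm_num) (hc.intervalIntegrable _ _) (by simp)
    intro x _
    exact Real.smoothTransition.le_one _
  simpa using this

lemma le_Theta (w : ℝ) : w ≤ Theta w := by
  rcases le_total 0 w with h | h
  · rw [Theta_sub w h]; linarith [Theta_nonneg 0]
  · linarith [Theta_nonneg w]

lemma Theta_le (w : ℝ) : Theta w ≤ max w 0 + 1 := by
  rcases le_total 0 w with h | h
  · rw [Theta_sub w h, max_eq_left h]; linarith [Theta_zero_le]
  · rw [max_eq_right h]; linarith [Theta_zero_le, Theta_mono h]

lemma Theta_deriv_mul_le (w : ℝ) : Real.smoothTransition (w + 1) * w ≤ Theta w := by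
  rcases le_total 0 w with h | h
  · rw [Real.smoothTransition.one_of_one_le (by linarith), one_mul]; exact le_Theta w
  · have := mul_nonneg (Real.smoothTransition.nonneg (w+1)) (neg_nonneg.2 h)
    linarith [Theta_nonneg w]

lemma Theta_pos {w : ℝ} (h : -1 < w) : 0 < Theta w := by
  have hc : Continuous fun x : ℝ => Real.smoothTransition (x + 1) :=
    Real.smoothTransition.continuous.comp (by fun_prop)
  apply intervalIntegral.intervalIntegral_pos_of_pos_on (hc.intervalIntegrable _ _) _ h
  intro x hx
  exact Real.smoothTransition.pos_of_pos (by linarith [hx.1])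

lemma sT_hasDerivAt (w : ℝ) : ∃ d, 0 ≤ d ∧
    HasDerivAt (fun w => Real.smoothTransition (w + 1)) d w := by
  have hd : Differentiable ℝ (fun w : ℝ => Real.smoothTransition (w + 1)) :=
    (Real.smoothTransition.contDiff (n := 1)).differentiable (by norm_num) |>.comp (by fun_prop)
  refine ⟨_, ?_, (hd w).hasDerivAt⟩
  apply Monotone.deriv_nonneg
  intro x y hxy
  exact Real.smoothTransition.monotone (by linarith)

/-- Laplacian from a gradient field. -/
lemma lap_of_grad {N : ℕ} {φ : Euc N → ℝ} {g : Euc N → Euc N} {x : Euc N}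
    {g' : Euc N →L[ℝ] Euc N}
    (h1 : ∀ᶠ y in 𝓝 x, HasFDerivAt φ (innerSL ℝ (g y)) y) (h2 : HasFDerivAt g g' x) :
    lap φ x = ∑ i, g' (EuclideanSpace.single i 1) i := by
  unfold lap
  have h3 : fderiv ℝ φ =ᶠ[𝓝 x] fun y => innerSL ℝ (g y) := by
    filter_upwards [h1] with y hy using hy.fderiv
  have h4 : HasFDerivAt (fderiv ℝ φ) ((innerSL ℝ).toContinuousLinearMap.comp g') x :=
    (((innerSL ℝ).toContinuousLinearMap.hasFDerivAt).comp x h2).congr_of_eventuallyEq h3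
  refine Finset.sum_congr rfl fun i _ => ?_
  rw [iteratedFDeriv_two_apply, h4.fderiv]
  simp [EuclideanSpace.inner_single_right]

/-- Laplacian of a composition. -/
lemma lap_comp {N : ℕ} {φ W : Euc N → ℝ} {g : Euc N → Euc N} {x : Euc N}
    {g' : Euc N →L[ℝ] Euc N} {F F' : ℝ → ℝ} {F'' : ℝ}
    (h0 : ∀ᶠ y in 𝓝 x, φ y = F (W y))
    (h1 : ∀ᶠ y in 𝓝 x, HasFDerivAt W (innerSL ℝ (g y)) y) (h2 : HasFDerivAt g g' x)
    (hF : ∀ w, HasDerivAt F (F' w) w) (hF' : HasDerivAt F' F'' (W x)) :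
    lap φ x = F'' * ‖g x‖ ^ 2 + F' (W x) * ∑ i, g' (EuclideanSpace.single i 1) i := by
  have k1 : ∀ᶠ y in 𝓝 x, HasFDerivAt φ (innerSL ℝ (F' (W y) • g y)) y := by
    filter_upwards [h0.eventually_nhds, h1] with y hy0 hy1
    have := ((hF (W y)).comp_hasFDerivAt y hy1).congr_of_eventuallyEq hy0
    simpa using this
  have k2 : HasFDerivAt (fun y => F' (W y) • g y) _ x :=
    (hF'.comp_hasFDerivAt x h1.self_of_nhds).smul h2
  rw [lap_of_grad k1 k2]
  simp only [ContinuousLinearMap.add_apply, ContinuousLinearMap.smul_apply,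
    ContinuousLinearMap.smulRight_apply, PiLp.add_apply, PiLp.smul_apply, smul_eq_mul,
    Finset.sum_add_distrib, Finset.mul_sum, innerSL_apply_apply, EuclideanSpace.inner_single_right,
    EuclideanSpace.real_norm_sq_eq]
  rw [add_comm]
  congr 1
  refine Finset.sum_congr rfl fun i _ => ?_
  simp
  ring

/-- `τ = - log |x|`. -/
def tau {N : ℕ} (x : Euc N) : ℝ := -(1/2) * Real.log (‖x‖ ^ 2)

/-- the barrier ansatz -/
def Wf {N : ℕ} (e : Euc N) (p1 p2 p3 : ℝ → ℝ) (x : Euc N) : ℝ :=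
  ⟪e, x⟫ * p1 (tau x) + ⟪e, x⟫ ^ 2 * p2 (tau x) - p3 (tau x)

def Gf {N : ℕ} (e : Euc N) (p1 p2 d1 d2 d3 : ℝ → ℝ) (x : Euc N) : Euc N :=
  (p1 (tau x) + 2 * ⟪e, x⟫ * p2 (tau x)) • e +
  (-(⟪e, x⟫ * d1 (tau x) + ⟪e, x⟫ ^ 2 * d2 (tau x) - d3 (tau x)) * (‖x‖ ^ 2)⁻¹) • x

lemma normsq_hasFDerivAt {N : ℕ} (x : Euc N) :
    HasFDerivAt (fun y : Euc N => ‖y‖ ^ 2) (2 • innerSL ℝ x) x :=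
  (hasStrictFDerivAt_norm_sq x).hasFDerivAt

lemma tau_hasFDerivAt {N : ℕ} {x : Euc N} (hx : x ≠ 0) :
    HasFDerivAt tau ((-(‖x‖ ^ 2)⁻¹) • innerSL ℝ x) x := by
  have h : ‖x‖ ^ 2 ≠ 0 := by positivity
  have := ((normsq_hasFDerivAt x).log h).const_mul (-(1/2) : ℝ)
  refine HasFDerivAt.congr_fderiv (f := _) this ?_
  refine ContinuousLinearMap.ext fun v => ?_
  simp
  ring

lemma ell_hasFDerivAt {N : ℕ} (e x : Euc N) :
    HasFDerivAt (fun y : Euc N => ⟪e, y⟫) (innerSL ℝ e) x := (innerSL ℝ e).hasFDerivAt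

lemma Wf_hasFDerivAt {N : ℕ} (e : Euc N) {p1 p2 p3 d1 d2 d3 : ℝ → ℝ}
    (h1 : ∀ t, HasDerivAt p1 (d1 t) t) (h2 : ∀ t, HasDerivAt p2 (d2 t) t)
    (h3 : ∀ t, HasDerivAt p3 (d3 t) t) {x : Euc N} (hx : x ≠ 0) :
    HasFDerivAt (Wf e p1 p2 p3) (innerSL ℝ (Gf e p1 p2 d1 d2 d3 x)) x := by
  have ht := tau_hasFDerivAt hx
  have he := ell_hasFDerivAt e x
  have q1 := he.mul ((h1 (tau x)).comp_hasFDerivAt x ht)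
  have q2 := (he.pow 2).mul ((h2 (tau x)).comp_hasFDerivAt x ht)
  have q3 := ((h3 (tau x)).comp_hasFDerivAt x ht)
  have := (q1.add q2).sub q3
  refine HasFDerivAt.congr_fderiv (f := _) this ?_
  refine ContinuousLinearMap.ext fun v => ?_
  simp [Gf, inner_add_left, inner_smul_left]
  ring

lemma Gf_hasFDerivAt {N : ℕ} (e : Euc N) (he1 : ‖e‖ = 1) {p1 p2 d1 d2 d3 c1 c2 c3 : ℝ → ℝ}
    (h1 : ∀ t, HasDerivAt p1 (d1 t) t) (h2 : ∀ t, HasDerivAt p2 (d2 t) t)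
    (k1 : ∀ t, HasDerivAt d1 (c1 t) t) (k2 : ∀ t, HasDerivAt d2 (c2 t) t)
    (k3 : ∀ t, HasDerivAt d3 (c3 t) t)
    {x : Euc N} (hx : x ≠ 0) :
    ∃ g' : Euc N →L[ℝ] Euc N, HasFDerivAt (Gf e p1 p2 d1 d2 d3) g' x ∧
      ∑ i, g' (EuclideanSpace.single i 1) i =
      (⟪e, x⟫ * (c1 (tau x) - N * d1 (tau x)) + ⟪e, x⟫ ^ 2 * (c2 (tau x) - (N + 2) * d2 (tau x))
        - (c3 (tau x) - (N - 2) * d3 (tau x))) * (‖x‖ ^ 2)⁻¹ + 2 * p2 (tau x) := by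
  have ht := tau_hasFDerivAt hx
  have he := ell_hasFDerivAt e x
  have hq : ‖x‖ ^ 2 ≠ 0 := by positivity
  have hqi := (hasDerivAt_inv hq).comp_hasFDerivAt x (normsq_hasFDerivAt x)
  have a1 := ((h1 (tau x)).comp_hasFDerivAt x ht).add
    ((he.const_mul 2).mul ((h2 (tau x)).comp_hasFDerivAt x ht))
  have b1 := (((he.mul ((k1 (tau x)).comp_hasFDerivAt x ht)).add
    ((he.pow 2).mul ((k2 (tau x)).comp_hasFDerivAt x ht))).sub
    ((k3 (tau x)).comp_hasFDerivAt x ht)).neg.mul hqi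
  have tot := (a1.smul_const e).add (b1.smul (hasFDerivAt_id x))
  refine ⟨_, tot, ?_⟩
  have s1 : ∑ i, (e i) * (e i) = 1 := by
    have := EuclideanSpace.real_norm_sq_eq e
    rw [he1] at this
    rw [← one_pow 2, this]; exact Finset.sum_congr rfl fun i _ => by ring
  have s2 : ∑ i, (e i) * (x i) = ⟪e, x⟫ := by
    rw [PiLp.inner_apply]
    exact Finset.sum_congr rfl fun i _ => by simp; ring
  have s3 : ∑ i, (x i) * (x i) = ‖x‖ ^ 2 := by
    rw [EuclideanSpace.real_norm_sq_eq]
    exact Finset.sum_congr rfl fun i _ => by ring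
  set P := p1 (tau x)
  set P2 := p2 (tau x) with hP2
  set D1 := d1 (tau x) with hD1
  set D2 := d2 (tau x) with hD2
  set D3 := d3 (tau x) with hD3
  set C1 := c1 (tau x)
  set C2 := c2 (tau x)
  set C3 := c3 (tau x)
  set L := ⟪e, x⟫ with hL
  set q := ‖x‖ ^ 2
  set B := L * D1 + L ^ 2 * D2 - D3 with hB
  have key : ∀ i : Fin N, (((-q⁻¹ * x i) * D1 + (2 * e i) * P2 + (2 * L) * (D2 * (-q⁻¹ * x i))) * e i +
     (-(e i * D1 + L * (C1 * (-q⁻¹ * x i)) + 2 * L * e i * D2 + L ^ 2 * (C2 * (-q⁻¹ * x i))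
       - C3 * (-q⁻¹ * x i)) * q⁻¹ + B * (2 * x i) * (q ^ 2)⁻¹) * x i + (- B * q⁻¹) * 1)
     = (2 * P2) * (e i * e i) + (-q⁻¹ * (2 * D1 + 4 * L * D2)) * (e i * x i)
       + ((L * C1 + L ^ 2 * C2 - C3) * q⁻¹ ^ 2 + 2 * B * (q ^ 2)⁻¹) * (x i * x i) + (- B * q⁻¹) := by
    intro i; ring
  trans ∑ i : Fin N, (((-q⁻¹ * x i) * D1 + (2 * e i) * P2 + (2 * L) * (D2 * (-q⁻¹ * x i))) * e i +
     (-(e i * D1 + L * (C1 * (-q⁻¹ * x i)) + 2 * L * e i * D2 + L ^ 2 * (C2 * (-q⁻¹ * x i))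
       - C3 * (-q⁻¹ * x i)) * q⁻¹ + B * (2 * x i) * (q ^ 2)⁻¹) * x i + (- B * q⁻¹) * 1)
  · refine Finset.sum_congr rfl fun i _ => ?_
    simp [EuclideanSpace.inner_single_right, ← hL, ← hP2, ← hD1, ← hD2, ← hD3, hB]
    ring
  · rw [Finset.sum_congr rfl fun i _ => key i]
    simp only [Finset.sum_add_distrib, ← Finset.mul_sum, s1, s2, s3]
    simp
    field_simp
    rw [hB]
    ring

lemma tau_contDiffAt {N : ℕ} {x : Euc N} (hx : x ≠ 0) : ContDiffAt ℝ (⊤ : ℕ∞) (tau (N := N)) x := by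
  have h : ‖x‖ ^ 2 ≠ 0 := by positivity
  have h2 : ContDiffAt ℝ (⊤ : ℕ∞) (fun y : Euc N => ‖y‖ ^ 2) x := (contDiff_norm_sq ℝ).contDiffAt
  exact contDiffAt_const.mul (h2.log h)

lemma Wf_contDiffAt {N : ℕ} (e : Euc N) {p1 p2 p3 : ℝ → ℝ}
    (h1 : ContDiff ℝ (⊤ : ℕ∞) p1) (h2 : ContDiff ℝ (⊤ : ℕ∞) p2) (h3 : ContDiff ℝ (⊤ : ℕ∞) p3)
    {x : Euc N} (hx : x ≠ 0) : ContDiffAt ℝ (⊤ : ℕ∞) (Wf e p1 p2 p3) x := by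
  have ht := tau_contDiffAt hx
  have he : ContDiffAt ℝ (⊤ : ℕ∞) (fun y : Euc N => ⟪e, y⟫) x := (innerSL ℝ e).contDiff.contDiffAt
  exact ((he.mul (h1.contDiffAt.comp x ht)).add ((he.pow 2).mul (h2.contDiffAt.comp x ht))).sub
    (h3.contDiffAt.comp x ht)

/-- one-dimensional profile -/
structure IsProfile (s ε Q K H τ0 t2 bmax η : ℝ) (ψ dψ ddψ b : ℝ → ℝ) (τ1 g β : ℝ) : Prop where
  smooth : ContDiff ℝ (⊤ : ℕ∞) ψ
  d1 : ∀ t, HasDerivAt ψ (dψ t) t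
  d2 : ∀ t, HasDerivAt dψ (ddψ t) t
  ht : t2 < τ1
  left : ψ τ0 + K * Real.exp ((s - ε) * τ0) ≤ 0
  right : ψ τ1 + K * Real.exp ((s - ε) * τ1) ≤ 0
  b0 : ∀ t, τ0 ≤ t → t ≤ τ1 → 0 ≤ b t
  b1 : ∀ t, τ0 ≤ t → t ≤ τ1 → b t ≤ bmax
  ode : ∀ t, τ0 ≤ t → t ≤ τ1 →
    - ddψ t + s ^ 2 * ψ t + H * Real.exp ((s - ε) * t) ≤ b t * max (ψ t) 0
  top : ∀ t, τ0 ≤ t → t ≤ τ1 → ψ t + K * Real.exp ((s - ε) * t) ≤ Real.exp ((s - ε + 1) * t)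
  small : ∀ t, τ0 ≤ t → t ≤ τ1 →
    b t ^ Q * (Real.exp (-(s * t)) * max (ψ t + K * Real.exp ((s - ε) * t)) 0)
      ≤ g * Real.exp (-(β * t))
  g0 : 0 < g
  β0 : 0 < β
  gη : g ≤ η * β

set_option maxHeartbeats 2000000 in
lemma profile_zero (Q : ℝ) (hQ : 1 < Q) : ∀ K H τ0 : ℝ, 0 < K → 0 < H → 0 ≤ τ0 →
    ∃ τ t1 t2 m : ℝ, τ0 ≤ τ ∧ τ < t1 ∧ t1 < t2 ∧ 0 < m ∧ ∀ η > 0,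
      ∃ (ψ dψ ddψ b : ℝ → ℝ) (τ1 g β : ℝ), IsProfile 0 (1/2) Q K H τ t2 1 η ψ dψ ddψ b τ1 g β ∧
        ∀ t, t1 ≤ t → t ≤ t2 → m ≤ ψ t := by
  intro K H τ0 hK hH hτ0
  set M := 4 * H + K with hM
  have hMp : 0 < M := by positivity
  set τ := τ0 + M with hτ
  set h := 2 * M + 1 with hh
  set θ := τ + h with hθ
  refine ⟨τ, θ + 1, θ + 2, 1/2, by linarith, by linarith, by linarith, by norm_num, ?_⟩
  intro η hη
  have hexp : ∀ t, τ ≤ t → M * Real.exp ((0 - 1/2) * t) ≤ Real.exp ((0 - 1/2 + 1) * t) := by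
    intro t ht
    have h1 : M ≤ Real.exp t := by linarith [Real.add_one_le_exp t]
    have : Real.exp ((0 - 1/2 + 1) * t) = Real.exp t * Real.exp ((0 - 1/2) * t) := by
      rw [← Real.exp_add]; ring_nf
    rw [this]; gcongr
  have hexp1 : ∀ t, 0 ≤ t → Real.exp ((0 - 1/2 : ℝ) * t) ≤ 1 := by
    intro t ht
    rw [Real.exp_le_one_iff]; linarith
  -- choose β
  have e1 : ∀ᶠ β : ℝ in 𝓝[>] 0, 2 * Real.exp 6 * β ^ (2 * Q - 2) < η := by
    have : Tendsto (fun β : ℝ => 2 * Real.exp 6 * β ^ (2 * Q - 2)) (𝓝[>] 0) (𝓝 0) := by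
      have h1 : ContinuousAt (fun β : ℝ => β ^ (2 * Q - 2)) 0 :=
        Real.continuousAt_rpow_const _ _ (Or.inr (by linarith))
      have h2 := (h1.tendsto.const_mul (2 * Real.exp 6)).mono_left (nhdsWithin_le_nhds (s := Set.Ioi 0))
      simpa [Real.zero_rpow (show 2 * Q - 2 ≠ 0 by linarith)] using h2
    exact this.eventually_lt_const hη
  have e2 : ∀ᶠ β : ℝ in 𝓝[>] 0, β < 1 / (θ + 2) := by
    apply Filter.Eventually.filter_mono nhdsWithin_le_nhds
    exact eventually_lt_nhds (by positivity)
  obtain ⟨β, ⟨hβη, hβ1⟩, hβ0⟩ := ((e1.and e2).and self_mem_nhdsWithin).exists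
  replace hβ0 : 0 < β := hβ0
  have hβθ : β * (θ + 2) < 1 := by rwa [lt_div_iff₀ (by positivity)] at hβ1
  have hβle : β < 1 := by nlinarith
  have hβM : β * M < 1 := by nlinarith
  have hβh : β * h < 1 := by nlinarith
  have hpi := Real.pi_gt_three
  have hpi4 := Real.pi_le_four
  have hsin : ∀ x, 0 ≤ x → x ≤ 1 → x / 2 ≤ Real.sin x := by
    intro x hx hx1
    have := Real.mul_le_sin hx (by linarith)
    have h2 : 1/2 ≤ 2 / Real.pi := by rw [div_le_div_iff₀] <;> linarith
    nlinarith
  have hsinle : ∀ t, τ ≤ t → Real.sin (β * (t - θ)) / β ≤ max (t - θ) 0 := by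
    intro t ht
    rcases le_total 0 (t - θ) with h0 | h0
    · rw [max_eq_left h0, div_le_iff₀ hβ0]
      have := Real.sin_le (mul_nonneg hβ0.le h0)
      linarith
    · rw [max_eq_right h0]
      apply div_nonpos_of_nonpos_of_nonneg _ hβ0.le
      apply Real.sin_nonpos_of_nonpos_of_neg_pi_le
      · nlinarith
      · nlinarith
  have hτ1 : β * (θ + Real.pi / β + h) ≤ 6 := by
    have : β * (θ + Real.pi / β + h) = β * θ + Real.pi + β * h := by field_simp
    nlinarith
  refine ⟨fun t => Real.sin (β * (t - θ)) / β + 4 * H * Real.exp ((0 - 1/2) * t),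
    fun t => Real.cos (β * (t - θ)) - 2 * H * Real.exp ((0 - 1/2) * t),
    fun t => -β * Real.sin (β * (t - θ)) + H * Real.exp ((0 - 1/2) * t),
    fun _ => β ^ 2, θ + Real.pi / β + h, (β ^ 2) ^ Q * (2 / β) * Real.exp 6, β,
    ⟨?_, ?_, ?_, ?_, ?_, ?_, ?_, ?_, ?_, ?_, ?_, ?_, ?_, ?_⟩, ?_⟩
  · fun_prop
  · intro t
    have k1 : HasDerivAt (fun t => β * (t - θ)) β t := by
      simpa using ((hasDerivAt_id t).sub_const θ).const_mul β
    have k2 : HasDerivAt (fun t : ℝ => (0 - 1/2) * t) (0 - 1/2) t := by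
      simpa using (hasDerivAt_id t).const_mul (0 - 1/2 : ℝ)
    have := (k1.sin.div_const β).add (k2.exp.const_mul (4 * H))
    refine this.congr_deriv ?_
    field_simp
    ring
  · intro t
    have k1 : HasDerivAt (fun t => β * (t - θ)) β t := by
      simpa using ((hasDerivAt_id t).sub_const θ).const_mul β
    have k2 : HasDerivAt (fun t : ℝ => (0 - 1/2) * t) (0 - 1/2) t := by
      simpa using (hasDerivAt_id t).const_mul (0 - 1/2 : ℝ)
    have := (k1.cos).sub (k2.exp.const_mul (2 * H))
    refine this.congr_deriv ?_
    ring
  · have : Real.pi ≤ Real.pi / β := by rw [le_div_iff₀ hβ0]; nlinarith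
    linarith
  · have k1 : β * (τ - θ) = -(β * h) := by rw [hθ]; ring
    have k2 := hsin (β * h) (by positivity) hβh.le
    have k3 := hexp1 τ (by linarith)
    beta_reduce
    rw [k1, Real.sin_neg]
    have k4 : h / 2 ≤ Real.sin (β * h) / β := by rw [le_div_iff₀ hβ0]; linarith
    rw [neg_div]
    nlinarith
  · have k1 : β * (θ + Real.pi / β + h - θ) = β * h + Real.pi := by field_simp; ring
    have k2 := hsin (β * h) (by positivity) hβh.le
    have k3 := hexp1 (θ + Real.pi / β + h) (by positivity)
    beta_reduce
    rw [k1, Real.sin_add_pi]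
    have k4 : h / 2 ≤ Real.sin (β * h) / β := by rw [le_div_iff₀ hβ0]; linarith
    rw [neg_div]
    nlinarith
  · intro t _ _; positivity
  · intro t _ _
    show β ^ 2 ≤ 1
    nlinarith
  · intro t _ _
    beta_reduce
    have k := Real.exp_pos ((0 - 1/2 : ℝ) * t)
    rcases le_total 0 (Real.sin (β * (t - θ))) with h0 | h0
    · have k2 : Real.sin (β * (t - θ)) / β ≤
        max (Real.sin (β * (t - θ)) / β + 4 * H * Real.exp ((0 - 1/2) * t)) 0 :=
        le_max_of_le_left (by have : 0 ≤ 4 * H * Real.exp ((0 - 1/2) * t) := by positivity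
                              linarith)
      have k3 : β * Real.sin (β * (t - θ)) = β ^ 2 * (Real.sin (β * (t - θ)) / β) := by field_simp
      have k4 := mul_le_mul_of_nonneg_left k2 (sq_nonneg β)
      nlinarith
    · have k2 : 0 ≤ β ^ 2 * max (Real.sin (β * (t - θ)) / β + 4 * H * Real.exp ((0 - 1/2) * t)) 0 := by
        positivity
      nlinarith
  · intro t ht1 _
    beta_reduce
    have k1 := hsinle t ht1
    have k2 := hexp t ht1
    rcases le_total 0 (t - θ) with h0 | h0
    · rw [max_eq_left h0] at k1
      have k3 := hexp1 t (by linarith)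
      have k4 : t ≤ Real.exp ((0 - 1/2 + 1) * t) := by
        have : Real.exp ((0 - 1/2 + 1) * t) = Real.exp (t/4) * Real.exp (t/4) := by
          rw [← Real.exp_add]; ring_nf
        rw [this]
        have := Real.add_one_le_exp (t/4)
        nlinarith [sq_nonneg (t/4 - 1)]
      nlinarith
    · rw [max_eq_right h0] at k1
      linarith
  · intro t ht1 ht2
    beta_reduce
    have k3 := hexp1 t (by linarith)
    have k5 : Real.sin (β * (t - θ)) / β ≤ 1 / β := by
      gcongr; exact Real.sin_le_one _
    have k6 : M ≤ 1 / β := by rw [le_div_iff₀ hβ0]; linarith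
    have k7 : max (Real.sin (β * (t - θ)) / β + 4 * H * Real.exp ((0 - 1/2) * t)
        + K * Real.exp ((0 - 1/2) * t)) 0 ≤ 2 / β := by
      apply max_le _ (by positivity)
      have : 2 / β = 1 / β + 1 / β := by ring
      nlinarith
    have k8 : 1 ≤ Real.exp 6 * Real.exp (-(β * t)) := by
      rw [← Real.exp_add, Real.one_le_exp_iff]
      nlinarith
    rw [zero_mul, neg_zero, Real.exp_zero, one_mul, mul_assoc _ (Real.exp 6)]
    calc _ ≤ (β ^ 2) ^ Q * (2 / β) := by gcongr
      _ = (β ^ 2) ^ Q * (2 / β) * 1 := by ring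
      _ ≤ _ := by gcongr
  · positivity
  · exact hβ0
  · have k1 : (β ^ 2) ^ Q = β ^ (2 * Q - 2) * β ^ 2 := by
      rw [← Real.rpow_natCast β 2, ← Real.rpow_mul hβ0.le, ← Real.rpow_add hβ0]
      push_cast; ring_nf
    rw [k1]
    have : β ^ (2 * Q - 2) * β ^ 2 * (2 / β) * Real.exp 6 = (2 * Real.exp 6 * β ^ (2 * Q - 2)) * β := by
      field_simp
    rw [this]
    gcongr
  · intro t ht1 ht2
    beta_reduce
    have k2 := hsin (β * (t - θ)) (by apply mul_nonneg hβ0.le; linarith) (by nlinarith)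
    have k4 : (t - θ) / 2 ≤ Real.sin (β * (t - θ)) / β := by rw [le_div_iff₀ hβ0]; linarith
    have := Real.exp_pos ((0 - 1/2 : ℝ) * t)
    have : 0 ≤ 4 * H * Real.exp ((0 - 1/2) * t) := by positivity
    linarith

/-- logistic function -/
def vlog (T t : ℝ) : ℝ := Real.exp (t - T) / (1 + Real.exp (t - T))
/-- basic one-dimensional function -/
def flog (w k T t : ℝ) : ℝ := Real.exp (w * t - k * Real.log (1 + Real.exp (t - T)))

lemma vlog_pos (T t : ℝ) : 0 < vlog T t := by unfold vlog; positivity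
lemma vlog_lt (T t : ℝ) : vlog T t < 1 := by
  unfold vlog; rw [div_lt_one (by positivity)]; linarith
lemma vlog_le (T t : ℝ) : vlog T t ≤ Real.exp (t - T) := by
  unfold vlog
  have := Real.exp_pos (t - T)
  exact div_le_self this.le (by linarith)
lemma vlog_half (T t : ℝ) (h : vlog T t ≤ 1/2) : Real.exp (t - T) ≤ 1 := by
  unfold vlog at h
  rw [div_le_iff₀ (by positivity)] at h
  linarith

lemma lin_hasDerivAt (a t : ℝ) : HasDerivAt (fun t : ℝ => a * t) a t := by
  simpa using (hasDerivAt_id t).const_mul a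

lemma ez_hasDerivAt (T t : ℝ) : HasDerivAt (fun t => 1 + Real.exp (t - T)) (Real.exp (t - T)) t := by
  have := (((hasDerivAt_id t).sub_const T).exp).const_add 1
  simpa using this

lemma vlog_hasDerivAt (T t : ℝ) : HasDerivAt (vlog T) (vlog T t * (1 - vlog T t)) t := by
  have h0 : HasDerivAt (fun t => Real.exp (t - T)) (Real.exp (t - T)) t := by
    simpa using ((hasDerivAt_id t).sub_const T).exp
  have h1 := h0.div (ez_hasDerivAt T t) (by positivity)
  refine h1.congr_deriv ?_
  unfold vlog
  have : (1 + Real.exp (t - T)) ≠ 0 := by positivity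
  field_simp

lemma flog_hasDerivAt (w k T t : ℝ) :
    HasDerivAt (flog w k T) (flog w k T t * (w - k * vlog T t)) t := by
  have h1 := (lin_hasDerivAt w t).sub (((ez_hasDerivAt T t).log (by positivity)).const_mul k)
  exact h1.exp

lemma flog_contDiff (w k T : ℝ) : ContDiff ℝ (⊤ : ℕ∞) (flog w k T) := by
  unfold flog
  have : ContDiff ℝ (⊤ : ℕ∞) (fun t => Real.log (1 + Real.exp (t - T))) := by
    apply ContDiff.log
    · fun_prop
    · intro x; positivity
  fun_prop

lemma flog_le (w k T t : ℝ) (hk : 0 ≤ k) : flog w k T t ≤ Real.exp (w * t) := by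
  unfold flog
  rw [Real.exp_le_exp]
  have : 0 ≤ Real.log (1 + Real.exp (t - T)) := Real.log_nonneg (by linarith [Real.exp_pos (t-T)])
  nlinarith

lemma flog_le' (w k T t : ℝ) (hk : 0 ≤ k) : flog w k T t ≤ Real.exp (w * t - k * (t - T)) := by
  unfold flog
  rw [Real.exp_le_exp]
  have : t - T ≤ Real.log (1 + Real.exp (t - T)) := by
    rw [Real.le_log_iff_exp_le (by positivity)]; linarith
  nlinarith

lemma flog_ge (w k T t : ℝ) (hk : 0 ≤ k) (h : Real.exp (t - T) ≤ 1) :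
    Real.exp (w * t - k * Real.log 2) ≤ flog w k T t := by
  unfold flog
  rw [Real.exp_le_exp]
  have : Real.log (1 + Real.exp (t - T)) ≤ Real.log 2 :=
    Real.log_le_log (by positivity) (by linarith)
  nlinarith

lemma rpow_add_le2 (a b Q : ℝ) (ha : 0 ≤ a) (hb : 0 ≤ b) (hQ : 0 ≤ Q) :
    (a + b) ^ Q ≤ 2 ^ Q * (a ^ Q + b ^ Q) := by
  have h1 := Real.rpow_nonneg ha Q
  have h2 := Real.rpow_nonneg hb Q
  have h3 : (0:ℝ) ≤ 2 ^ Q := by positivity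
  rcases le_total a b with h | h
  · calc (a + b) ^ Q ≤ (2 * b) ^ Q := Real.rpow_le_rpow (by positivity) (by linarith) hQ
      _ = 2 ^ Q * b ^ Q := Real.mul_rpow (by norm_num) hb
      _ ≤ _ := by gcongr; linarith
  · calc (a + b) ^ Q ≤ (2 * a) ^ Q := Real.rpow_le_rpow (by positivity) (by linarith) hQ
      _ = 2 ^ Q * a ^ Q := Real.mul_rpow (by norm_num) ha
      _ ≤ _ := by gcongr; linarith

set_option maxHeartbeats 2000000 in
lemma profile_pos (s Q : ℝ) (hs : 0 < s) (hQ : 1 < Q) : ∀ K H τ0 : ℝ, 0 < K → 0 < H → 0 ≤ τ0 →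
    ∃ τ t1 t2 m : ℝ, τ0 ≤ τ ∧ τ < t1 ∧ t1 < t2 ∧ 0 < m ∧ ∀ η > 0,
      ∃ (ψ dψ ddψ b : ℝ → ℝ) (τ1 g β : ℝ),
        IsProfile s (min 1 s) Q K H τ t2 (4 * s ^ 2 + 2 * ((4 * s + 1) * (2 * s + 1))) η
          ψ dψ ddψ b τ1 g β ∧
        ∀ t, t1 ≤ t → t ≤ t2 → m ≤ ψ t := by
  intro K H τ0 hK hH hτ0
  obtain ⟨ε, hεd⟩ : ∃ ε, ε = min 1 s := ⟨_, rfl⟩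
  have hε : 0 < ε := by rw [hεd]; positivity
  have hε1 : ε ≤ 1 := by rw [hεd]; exact min_le_left _ _
  have hεs : ε ≤ s := by rw [hεd]; exact min_le_right _ _
  rw [← hεd]
  obtain ⟨k, hk⟩ : ∃ k, k = 4 * s + 1 := ⟨_, rfl⟩
  obtain ⟨C, hC⟩ : ∃ C, C = (4 * s + 1) * (2 * s + 1) := ⟨_, rfl⟩
  have hCp : 0 < C := by rw [hC]; positivity
  have hkp : 0 < k := by rw [hk]; positivity
  rw [← hC]
  obtain ⟨Λ, hΛ⟩ : ∃ Λ, Λ = K + Real.exp (ε * τ0) + 2 * H / (ε * s) := ⟨_, rfl⟩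
  have hΛK : K + Real.exp (ε * τ0) ≤ Λ := by
    have : 0 ≤ 2 * H / (ε * s) := by positivity
    linarith
  have hΛH : H ≤ Λ * (ε * s) / 2 := by
    have : 2 * H / (ε * s) ≤ Λ := by linarith [Real.exp_pos (ε * τ0)]
    rw [div_le_iff₀ (by positivity)] at this
    linarith
  have hΛ0 : 0 < Λ := by linarith [Real.exp_pos (ε * τ0)]
  have hΛ1 : K + 1 ≤ Λ := by
    have : 1 ≤ Real.exp (ε * τ0) := Real.one_le_exp (by positivity)
    linarith
  obtain ⟨t1, ht1, ht1τ⟩ : ∃ t1, (2 * Λ + 1 ≤ Real.exp (ε / 2 * t1 - k * Real.log 2)) ∧ τ0 < t1 := by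
    have h1 : Tendsto (fun t : ℝ => ε / 2 * t - k * Real.log 2) atTop atTop :=
      tendsto_atTop_add_const_right _ _ (tendsto_id.const_mul_atTop (by positivity))
    have h2 := Real.tendsto_exp_atTop.comp h1
    exact ((h2.eventually_ge_atTop (2 * Λ + 1)).and (eventually_gt_atTop τ0)).exists
  refine ⟨τ0, t1, t1 + 1, 1, le_rfl, ht1τ, by linarith, one_pos, ?_⟩
  intro η hη
  -- choose β
  have e1 : ∀ᶠ β : ℝ in 𝓝[>] 0, 2 ^ Q * (4 * s) ^ Q * β ^ (Q - 1) < η / 4 := by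
    have : Tendsto (fun β : ℝ => 2 ^ Q * (4 * s) ^ Q * β ^ (Q - 1)) (𝓝[>] 0) (𝓝 0) := by
      have h1 : ContinuousAt (fun β : ℝ => β ^ (Q - 1)) 0 :=
        Real.continuousAt_rpow_const _ _ (Or.inr (by linarith))
      have h2 := (h1.tendsto.const_mul (2 ^ Q * (4 * s) ^ Q)).mono_left
        (nhdsWithin_le_nhds (s := Set.Ioi 0))
      simpa [Real.zero_rpow (show Q - 1 ≠ 0 by linarith)] using h2
    exact this.eventually_lt_const (by positivity)
  have e2 : ∀ᶠ β : ℝ in 𝓝[>] 0, β < ε / 16 := by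
    apply Filter.Eventually.filter_mono nhdsWithin_le_nhds
    exact eventually_lt_nhds (by positivity)
  obtain ⟨β, ⟨hβη, hβ1⟩, hβ0⟩ := ((e1.and e2).and self_mem_nhdsWithin).exists
  replace hβ0 : 0 < β := hβ0
  obtain ⟨zs, hzs⟩ : ∃ zs, zs = ε * s / (8 * C) := ⟨_, rfl⟩
  have hzs0 : 0 < zs := by rw [hzs]; positivity
  have hCz : C * zs = ε * s / 8 := by rw [hzs]; field_simp
  obtain ⟨T, hT1, hT2, hT3⟩ : ∃ T, t1 + 1 < T ∧ t1 - Real.log zs ≤ T ∧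
      2 ^ Q * (2 * C) ^ Q * Real.exp (-(β / 2 * T)) < η * β / 4 := by
    have h1 : Tendsto (fun T : ℝ => β / 2 * T) atTop atTop := tendsto_id.const_mul_atTop (by positivity)
    have h2 := (Real.tendsto_exp_neg_atTop_nhds_zero.comp h1).const_mul (2 ^ Q * (2 * C) ^ Q)
    rw [mul_zero] at h2
    obtain ⟨T, h3, h4, h5⟩ := ((eventually_gt_atTop (t1 + 1)).and ((eventually_ge_atTop
      (t1 - Real.log zs)).and (h2.eventually_lt_const (show 0 < η * β / 4 by positivity)))).exists
    exact ⟨T, h3, h4, h5⟩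
  have hkε : 0 < k - ε := by linarith
  obtain ⟨τ1, hτ1⟩ : ∃ τ1, τ1 = k * T / (k - ε) := ⟨_, rfl⟩
  have hτ1' : (k - ε) * τ1 = k * T := by rw [hτ1]; field_simp
  have hτ1T : T ≤ τ1 := by
    rw [hτ1, le_div_iff₀ hkε]; nlinarith
  -- lower bound for f
  have hlow : ∀ t, t1 ≤ t → Real.exp (t - T) ≤ 1 →
      (2 * Λ + 1) * Real.exp ((s - ε) * t) ≤ flog (s - β) k T t := by
    intro t ht hz
    refine le_trans ?_ (flog_ge (s - β) k T t hkp.le hz)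
    calc (2 * Λ + 1) * Real.exp ((s - ε) * t)
        ≤ Real.exp (ε / 2 * t1 - k * Real.log 2) * Real.exp ((s - ε) * t) := by gcongr
      _ = Real.exp (ε / 2 * t1 - k * Real.log 2 + (s - ε) * t) := by rw [Real.exp_add]
      _ ≤ _ := by
        rw [Real.exp_le_exp]
        have : 0 ≤ t := by linarith
        nlinarith
  have hup : ∀ t, flog (s - β) k T t - Λ * Real.exp ((s - ε) * t) + K * Real.exp ((s - ε) * t)
      ≤ flog (s - β) k T t := by
    intro t
    have := Real.exp_pos ((s - ε) * t)
    nlinarith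
  refine ⟨fun t => flog (s - β) k T t - Λ * Real.exp ((s - ε) * t),
    fun t => flog (s - β) k T t * ((s - β) - k * vlog T t) - Λ * (s - ε) * Real.exp ((s - ε) * t),
    fun t => flog (s - β) k T t * (((s - β) - k * vlog T t) ^ 2 - k * (vlog T t * (1 - vlog T t)))
      - Λ * (s - ε) ^ 2 * Real.exp ((s - ε) * t),
    fun t => 2 * (2 * s * β + C * (vlog T t * max (1 - 2 * vlog T t) 0)), τ1,
    2 ^ Q * ((4 * s * β) ^ Q + (2 * C) ^ Q * Real.exp (-(β / 2 * T))), β / 2,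
    ⟨?_, ?_, ?_, ?_, ?_, ?_, ?_, ?_, ?_, ?_, ?_, ?_, ?_, ?_⟩, ?_⟩
  · have := flog_contDiff (s - β) k T
    fun_prop
  · intro t
    have := (flog_hasDerivAt (s - β) k T t).sub (((lin_hasDerivAt (s - ε) t).exp).const_mul Λ)
    refine this.congr_deriv ?_
    ring
  · intro t
    have h1 := (flog_hasDerivAt (s - β) k T t).mul
      (((vlog_hasDerivAt T t).const_mul k).const_sub (s - β))
    have := h1.sub (((lin_hasDerivAt (s - ε) t).exp).const_mul (Λ * (s - ε)))
    refine this.congr_deriv ?_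
    ring
  · linarith
  · beta_reduce
    have h1 := flog_le (s - β) k T τ0 hkp.le
    have h2 : Real.exp ((s - β) * τ0) ≤ Real.exp (ε * τ0) * Real.exp ((s - ε) * τ0) := by
      rw [← Real.exp_add, Real.exp_le_exp]; nlinarith
    have := Real.exp_pos ((s - ε) * τ0)
    nlinarith
  · beta_reduce
    have h1 := flog_le' (s - β) k T τ1 hkp.le
    have h2 : Real.exp ((s - β) * τ1 - k * (τ1 - T)) ≤ Real.exp ((s - ε) * τ1) := by
      rw [Real.exp_le_exp]; nlinarith
    have := Real.exp_pos ((s - ε) * τ1)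
    nlinarith
  · intro t _ _
    have := vlog_pos T t
    positivity
  · intro t _ _
    beta_reduce
    have h1 := vlog_pos T t
    have h2 := vlog_lt T t
    have h3 : vlog T t * max (1 - 2 * vlog T t) 0 ≤ 1 := by
      have : max (1 - 2 * vlog T t) 0 ≤ 1 := max_le (by linarith) (by norm_num)
      have h4 : 0 ≤ max (1 - 2 * vlog T t) 0 := le_max_right _ _
      nlinarith
    nlinarith
  · intro t ht _
    beta_reduce
    have h1 := vlog_pos T t
    have h2 := vlog_lt T t
    have hf : 0 < flog (s - β) k T t := Real.exp_pos _
    have he := Real.exp_pos ((s - ε) * t)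
    have hlow' := hlow t
    have hvz := vlog_le T t
    have hvh := vlog_half T t
    have hm0 : 0 ≤ max (1 - 2 * vlog T t) 0 := le_max_right _ _
    have hm1 : max (1 - 2 * vlog T t) 0 ≤ 1 := max_le (by linarith) (by norm_num)
    have hm2 : 1 - 2 * vlog T t ≤ max (1 - 2 * vlog T t) 0 := le_max_left _ _
    have hm3 : 1/2 ≤ vlog T t → max (1 - 2 * vlog T t) 0 = 0 := fun h => max_eq_right (by linarith)
    generalize max (1 - 2 * vlog T t) 0 = μ at *
    generalize flog (s - β) k T t = f at *
    clear hlow hup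
    generalize vlog T t = v at *
    generalize Real.exp ((s - ε) * t) = κ at *
    have hb0 : 0 ≤ 2 * s * β + C * (v * μ) := by positivity
    have hX : s ^ 2 - ((s - β) - k * v) ^ 2 + k * (v * (1 - v)) ≤ 2 * s * β + C * (v * μ) := by
      have q1 : s ^ 2 - ((s - β) - k * v) ^ 2 + k * (v * (1 - v)) =
        2 * s * β - β ^ 2 + (k * v) * (2 * (s - β) + 1 - (k + 1) * v) := by ring
      have q2 : 2 * (s - β) + 1 - (k + 1) * v ≤ (2 * s + 1) * μ := by
        rw [hk]; nlinarith [mul_le_mul_of_nonneg_left hm2 (show 0 ≤ 2 * s + 1 by linarith)]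
      have q3 : (k * v) * (2 * (s - β) + 1 - (k + 1) * v) ≤ (k * v) * ((2 * s + 1) * μ) := by
        gcongr
      have q4 : (k * v) * ((2 * s + 1) * μ) = C * (v * μ) := by rw [hC, hk]; ring
      nlinarith [sq_nonneg β]
    have hXf := mul_le_mul_of_nonneg_left hX hf.le
    have hD : -(f * (((s - β) - k * v) ^ 2 - k * (v * (1 - v))) - Λ * (s - ε) ^ 2 * κ)
        + s ^ 2 * (f - Λ * κ) + H * κ ≤ (2 * s * β + C * (v * μ)) * f - Λ * (ε * s) / 2 * κ := by
      have q1 : H * κ ≤ Λ * (ε * s) / 2 * κ := by gcongr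
      have q2 : Λ * (s - ε) ^ 2 * κ ≤ Λ * κ * s ^ 2 - Λ * (ε * s) * κ := by
        have : (s - ε) ^ 2 ≤ s ^ 2 - ε * s := by nlinarith
        have := mul_le_mul_of_nonneg_left this (show 0 ≤ Λ * κ by positivity)
        linarith
      linarith
    refine hD.trans ?_
    by_cases hcase : 2 * Λ * κ ≤ f
    · rw [max_eq_left (by nlinarith)]
      have : f ≤ 2 * (f - Λ * κ) := by linarith
      have := mul_le_mul_of_nonneg_left this hb0
      have : 0 ≤ Λ * (ε * s) / 2 * κ := by positivity
      linarith
    · push Not at hcase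
      have hb : 2 * s * β + C * (v * μ) ≤ ε * s / 4 := by
        have q1 : 2 * s * β ≤ ε * s / 8 := by nlinarith
        have q2 : C * (v * μ) ≤ ε * s / 8 := by
          by_cases hv2 : 1/2 ≤ v
          · rw [hm3 hv2]; simp; positivity
          · push Not at hv2
            by_cases hvz2 : v ≤ zs
            · rw [← hCz]; gcongr; nlinarith
            · exfalso
              push Not at hvz2
              have : Real.log zs ≤ t - T := by
                rw [Real.log_le_iff_le_exp hzs0]; linarith
              have := hlow' (by linarith) (hvh hv2.le)
              nlinarith
        linarith
      have q5 : (2 * s * β + C * (v * μ)) * f ≤ ε * s / 4 * (2 * Λ * κ) := by gcongr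
      have : 0 ≤ 2 * (2 * s * β + C * (v * μ)) * max (f - Λ * κ) 0 := by positivity
      linarith
  · intro t ht _
    refine (hup t).trans ((flog_le _ _ _ _ hkp.le).trans ?_)
    rw [Real.exp_le_exp]
    have : 0 ≤ t := by linarith
    nlinarith
  · intro t ht _
    beta_reduce
    have h1 := vlog_pos T t
    have h2 := vlog_lt T t
    have ht0 : 0 ≤ t := by linarith
    have h3 : Real.exp (-(s * t)) * max (flog (s - β) k T t - Λ * Real.exp ((s - ε) * t)
        + K * Real.exp ((s - ε) * t)) 0 ≤ Real.exp (-(β * t)) := by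
      have : max (flog (s - β) k T t - Λ * Real.exp ((s - ε) * t)
        + K * Real.exp ((s - ε) * t)) 0 ≤ Real.exp ((s - β) * t) :=
        max_le ((hup t).trans (flog_le _ _ _ _ hkp.le)) (by positivity)
      calc _ ≤ Real.exp (-(s * t)) * Real.exp ((s - β) * t) := by gcongr
        _ = _ := by rw [← Real.exp_add]; ring_nf
    have hm0 : 0 ≤ max (1 - 2 * vlog T t) 0 := le_max_right _ _
    have hm1 : max (1 - 2 * vlog T t) 0 ≤ 1 := max_le (by linarith) (by norm_num)
    have h4 : 2 * (2 * s * β + C * (vlog T t * max (1 - 2 * vlog T t) 0)) ≤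
        4 * s * β + 2 * C * vlog T t := by
      have : C * (vlog T t * max (1 - 2 * vlog T t) 0) ≤ C * (vlog T t * 1) := by gcongr
      linarith
    have h5 : (2 * (2 * s * β + C * (vlog T t * max (1 - 2 * vlog T t) 0))) ^ Q ≤
        2 ^ Q * ((4 * s * β) ^ Q + (2 * C * vlog T t) ^ Q) := by
      refine (Real.rpow_le_rpow (by positivity) h4 (by linarith)).trans ?_
      exact rpow_add_le2 _ _ _ (by positivity) (by positivity) (by linarith)
    have h6 : vlog T t ^ Q ≤ vlog T t := by
      have := Real.rpow_le_rpow_of_exponent_ge h1 h2.le hQ.le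
      simpa using this
    have h7 : vlog T t * Real.exp (-(β * t)) ≤ Real.exp (-(β / 2 * T)) * Real.exp (-(β / 2 * t)) := by
      rcases le_total T t with h | h
      · calc _ ≤ 1 * Real.exp (-(β * t)) := by gcongr
          _ ≤ _ := by rw [one_mul, ← Real.exp_add, Real.exp_le_exp]; nlinarith
      · calc _ ≤ Real.exp (t - T) * Real.exp (-(β * t)) := by gcongr; exact vlog_le T t
          _ ≤ _ := by
            rw [← Real.exp_add, ← Real.exp_add, Real.exp_le_exp]
            nlinarith
    have h8 : Real.exp (-(β * t)) ≤ Real.exp (-(β / 2 * t)) := by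
      rw [Real.exp_le_exp]; nlinarith
    calc _ ≤ (2 ^ Q * ((4 * s * β) ^ Q + (2 * C * vlog T t) ^ Q)) * Real.exp (-(β * t)) := by
          apply mul_le_mul h5 h3 (by positivity) (by positivity)
      _ = 2 ^ Q * ((4 * s * β) ^ Q * Real.exp (-(β * t)) +
            (2 * C) ^ Q * (vlog T t ^ Q * Real.exp (-(β * t)))) := by
          rw [Real.mul_rpow (by positivity) h1.le]; ring
      _ ≤ 2 ^ Q * ((4 * s * β) ^ Q * Real.exp (-(β / 2 * t)) +
            (2 * C) ^ Q * (Real.exp (-(β / 2 * T)) * Real.exp (-(β / 2 * t)))) := by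
          have h9 : vlog T t ^ Q * Real.exp (-(β * t)) ≤
              Real.exp (-(β / 2 * T)) * Real.exp (-(β / 2 * t)) :=
            (mul_le_mul_of_nonneg_right h6 (by positivity)).trans h7
          have h10 := mul_le_mul_of_nonneg_left h9 (show 0 ≤ (2 * C) ^ Q by positivity)
          have h11 := mul_le_mul_of_nonneg_left h8 (show 0 ≤ (4 * s * β) ^ Q by positivity)
          exact mul_le_mul_of_nonneg_left (add_le_add h11 h10) (by positivity)
      _ = _ := by ring
  · positivity
  · positivity
  · have k1 : (4 * s * β) ^ Q = (4 * s) ^ Q * (β ^ (Q - 1) * β) := by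
      rw [Real.mul_rpow (by positivity) hβ0.le]
      congr 1
      conv_rhs => rw [← Real.rpow_add_one hβ0.ne']
      ring_nf
    rw [k1]
    have := mul_le_mul_of_nonneg_right hβη.le hβ0.le
    linarith
  · intro t h1 h2
    have hz : Real.exp (t - T) ≤ 1 := by rw [Real.exp_le_one_iff]; linarith
    have := hlow t h1 hz
    have h3 : 1 ≤ Real.exp ((s - ε) * t) := Real.one_le_exp (mul_nonneg (by linarith) (by linarith))
    beta_reduce
    nlinarith

lemma profile (s Q : ℝ) (hs : 0 ≤ s) (hQ : 1 < Q) : ∃ ε bmax : ℝ, 0 < ε ∧ ε ≤ 1 ∧ 0 < bmax ∧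
    ∀ K H τ0 : ℝ, 0 < K → 0 < H → 0 ≤ τ0 →
    ∃ τ t1 t2 m : ℝ, τ0 ≤ τ ∧ τ < t1 ∧ t1 < t2 ∧ 0 < m ∧ ∀ η > 0,
      ∃ (ψ dψ ddψ b : ℝ → ℝ) (τ1 g β : ℝ),
        IsProfile s ε Q K H τ t2 bmax η ψ dψ ddψ b τ1 g β ∧
        ∀ t, t1 ≤ t → t ≤ t2 → m ≤ ψ t := by
  rcases hs.eq_or_lt with rfl | h
  · exact ⟨1/2, 1, by norm_num, by norm_num, by norm_num, profile_zero Q hQ⟩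
  · exact ⟨min 1 s, _, by positivity, min_le_left _ _, by positivity, profile_pos s Q h hQ⟩

lemma cutoff {N : ℕ} {Ω R : Set (Euc N)} (hΩ : IsOpen Ω) (hR : IsCompact R)
    (W : Euc N → ℝ) (G : Euc N → Euc N) (L : Euc N → ℝ)
    (hW : ∀ x ∈ R, ContDiffAt ℝ (⊤ : ℕ∞) W x)
    (hG : ∀ x ∈ R, HasFDerivAt W (innerSL ℝ (G x)) x)
    (hL : ∀ x ∈ R, ∃ g' : Euc N →L[ℝ] Euc N, HasFDerivAt G g' x ∧
      ∑ i, g' (EuclideanSpace.single i 1) i = L x)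
    (hneg : ∀ x ∈ R, (x ∉ interior R ∨ x ∉ Ω) → W x < 0) :
    ∃ δ0 > 0, ∀ δ, 0 < δ → δ ≤ δ0 → ∃ φ : Euc N → ℝ, IsTestFun Ω φ ∧ (∀ x, 0 ≤ φ x) ∧
      (∀ x ∈ R, W x ≤ φ x) ∧
      (∀ x, (lap φ x = 0 ∧ φ x = 0) ∨ (x ∈ R ∧ x ∈ Ω ∧ φ x ≤ max (W x) 0 + δ ∧
        ∃ d, 0 ≤ d ∧ d * W x ≤ φ x ∧ d * L x ≤ lap φ x)) := by
  classical
  have hWc : ContinuousOn W R := fun x hx => (hW x hx).continuousAt.continuousWithinAt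
  obtain ⟨δ0, hδ0, hδZ⟩ : ∃ δ0 > 0, ∀ x ∈ R, (x ∉ interior R ∨ x ∉ Ω) → W x < -δ0 := by
    have hZ : IsCompact (R ∩ ((interior R)ᶜ ∪ Ωᶜ)) :=
      hR.inter_right (isOpen_interior.isClosed_compl.union hΩ.isClosed_compl)
    rcases (R ∩ ((interior R)ᶜ ∪ Ωᶜ)).eq_empty_or_nonempty with he | hne
    · refine ⟨1, one_pos, fun x hx h => ?_⟩
      have : x ∈ R ∩ ((interior R)ᶜ ∪ Ωᶜ) := ⟨hx, h⟩
      rw [he] at this; exact this.elim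
    · obtain ⟨z, hz, hmax⟩ := hZ.exists_isMaxOn hne (hWc.mono Set.inter_subset_left)
      have hzn := hneg z hz.1 hz.2
      refine ⟨-(W z) / 2, by linarith, fun x hx h => ?_⟩
      have : W x ≤ W z := hmax (show x ∈ R ∩ ((interior R)ᶜ ∪ Ωᶜ) from ⟨hx, h⟩)
      linarith
  refine ⟨δ0, hδ0, fun δ hδ hδle => ?_⟩
  set φ : Euc N → ℝ := fun x => if x ∈ R then δ * Theta (W x / δ) else 0 with hφ
  set S : Set (Euc N) := R ∩ W ⁻¹' (Set.Ici (-δ)) with hS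
  have hSc : IsClosed S := hWc.preimage_isClosed_of_isClosed hR.isClosed isClosed_Ici
  have hSR : S ⊆ R := Set.inter_subset_left
  have hSint : ∀ x ∈ S, x ∈ interior R ∧ x ∈ Ω := by
    intro x hx
    by_contra hcon
    rw [not_and_or] at hcon
    have h1 := hδZ x hx.1 hcon
    have h2 : -δ ≤ W x := hx.2
    linarith
  have hφ0 : ∀ x, x ∉ S → φ x = 0 := by
    intro x hx
    by_cases hxR : x ∈ R
    · have : W x < -δ := by
        by_contra h; exact hx ⟨hxR, by simpa using h⟩
      simp only [hφ, if_pos hxR]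
      rw [Theta_eq_zero, mul_zero]
      rw [div_le_iff₀ hδ]; linarith
    · simp only [hφ, if_neg hxR]
  have hev0 : ∀ x, x ∉ S → φ =ᶠ[𝓝 x] fun _ => 0 := by
    intro x hx
    filter_upwards [hSc.isOpen_compl.mem_nhds hx] with y hy using hφ0 y hy
  have hev1 : ∀ x ∈ S, ∀ᶠ y in 𝓝 x, φ y = δ * Theta (W y / δ) := by
    intro x hx
    filter_upwards [mem_interior_iff_mem_nhds.mp (hSint x hx).1] with y hy
    simp only [hφ, if_pos hy]
  have hsupp : tsupport φ ⊆ S := by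
    apply closure_minimal _ hSc
    intro x hx
    by_contra h
    exact hx (hφ0 x h)
  have hnn : ∀ x, 0 ≤ φ x := by
    intro x
    by_cases hxR : x ∈ R
    · simp only [hφ, if_pos hxR]
      exact mul_nonneg hδ.le (Theta_nonneg _)
    · simp only [hφ, if_neg hxR, le_refl]
  refine ⟨φ, ⟨?_, ?_, fun x hx => (hSint x (hsupp hx)).2⟩, hnn, ?_, ?_⟩
  · rw [contDiff_iff_contDiffAt]
    intro x
    by_cases hx : x ∈ S
    · have h1 : ContDiffAt ℝ (⊤ : ℕ∞) (fun y => δ * Theta (W y / δ)) x :=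
        contDiffAt_const.mul (Theta_contDiff.contDiffAt.comp x ((hW x hx.1).div_const δ))
      exact h1.congr_of_eventuallyEq (hev1 x hx)
    · exact contDiffAt_const.congr_of_eventuallyEq (hev0 x hx)
  · exact HasCompactSupport.intro' (hR.of_isClosed_subset hSc hSR) hSc (fun x hx => hφ0 x hx)
  · intro x hx
    simp only [hφ, if_pos hx]
    have := le_Theta (W x / δ)
    rw [div_le_iff₀ hδ] at this
    linarith
  · intro x
    by_cases hx : x ∈ S
    · right
      have hxR := hSR hx
      have hhin := hSint x hx
      refine ⟨hxR, hhin.2, ?_, Real.smoothTransition (W x / δ + 1),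
        Real.smoothTransition.nonneg _, ?_, ?_⟩
      · simp only [hφ, if_pos hxR]
        have h1 := Theta_le (W x / δ)
        have h2 := mul_le_mul_of_nonneg_left h1 hδ.le
        have h3 : δ * (max (W x / δ) 0 + 1) = max (W x) 0 + δ := by
          rw [mul_add, mul_max_of_nonneg _ _ hδ.le, mul_div_cancel₀ _ hδ.ne']; simp
        linarith
      · simp only [hφ, if_pos hxR]
        have h1 := mul_le_mul_of_nonneg_left (Theta_deriv_mul_le (W x / δ)) hδ.le
        have h3 : δ * (Real.smoothTransition (W x / δ + 1) * (W x / δ)) =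
          Real.smoothTransition (W x / δ + 1) * W x := by field_simp
        linarith
      · obtain ⟨g', hg', hgL⟩ := hL x hxR
        obtain ⟨d, hd, hdd⟩ := sT_hasDerivAt (W x / δ)
        have hlin : ∀ w, HasDerivAt (fun w : ℝ => w / δ) (1 / δ) w := fun w =>
          (hasDerivAt_id w).div_const δ
        have hF : ∀ w, HasDerivAt (fun w => δ * Theta (w / δ)) (Real.smoothTransition (w / δ + 1)) w := by
          intro w
          have := ((Theta_hasDerivAt (w / δ)).comp w (hlin w)).const_mul δ
          refine this.congr_deriv ?_
          field_simp
        have hF' : HasDerivAt (fun w => Real.smoothTransition (w / δ + 1)) (d * (1 / δ)) (W x) :=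
          HasDerivAt.comp (W x) (h₂ := fun w => Real.smoothTransition (w + 1)) hdd (hlin (W x))
        have h1 : ∀ᶠ y in 𝓝 x, HasFDerivAt W (innerSL ℝ (G y)) y := by
          filter_upwards [mem_interior_iff_mem_nhds.mp hhin.1] with y hy using hG y hy
        have := lap_comp (F := fun w => δ * Theta (w / δ)) (hev1 x hx) h1 hg' hF hF'
        rw [this, hgL]
        have : 0 ≤ d * (1 / δ) * ‖G x‖ ^ 2 := by positivity
        linarith
    · left
      refine ⟨?_, hφ0 x hx⟩
      unfold lap
      apply Finset.sum_eq_zero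
      intro i _
      rw [((hev0 x hx).iteratedFDeriv ℝ 2).eq_of_nhds]
      simp

lemma exp_tau {N : ℕ} {x : Euc N} (hx : x ≠ 0) : Real.exp (tau x) = ‖x‖⁻¹ := by
  have h : 0 < ‖x‖ := norm_pos_iff.2 hx
  unfold tau
  rw [Real.log_pow]
  push_cast
  rw [show -(1/2) * (2 * Real.log ‖x‖) = - Real.log ‖x‖ by ring, Real.exp_neg, Real.exp_log h]

lemma exp_neg_tau {N : ℕ} {x : Euc N} (hx : x ≠ 0) : Real.exp (-(tau x)) = ‖x‖ := by
  rw [Real.exp_neg, exp_tau hx, inv_inv]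

lemma expc_hasDerivAt (q a t : ℝ) : HasDerivAt (fun t => q * Real.exp (a * t)) (q * a * Real.exp (a * t)) t := by
  have := ((lin_hasDerivAt a t).exp).const_mul q
  refine this.congr_deriv ?_
  ring

lemma expψ_hasDerivAt (a t : ℝ) {ψ : ℝ → ℝ} {d : ℝ} (h : HasDerivAt ψ d t) :
    HasDerivAt (fun t => Real.exp (a * t) * ψ t) (Real.exp (a * t) * (d + a * ψ t)) t := by
  have := ((lin_hasDerivAt a t).exp).mul h
  refine this.congr_deriv ?_
  ring

/-- the algebraic inequality -/
lemma alg_ineq {n s ε K H a bm t ψ ddψ b κ : ℝ} (ht0 : 0 ≤ t) (ht1 : t ≤ 1) (hκ : 0 < κ)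
    (hs : 0 ≤ s) (hε : 0 < ε) (hε1 : ε ≤ 1) (hn : 2 ≤ n) (ha : 0 < a) (hK1 : a * n ≤ K) (hK2 : a * bm ≤ K)
    (hH : H = K * (n + 1 + 2 * s)) (hb0 : 0 ≤ b) (hb1 : b ≤ bm)
    (hode : -ddψ + s ^ 2 * ψ + H * κ ≤ b * max ψ 0) :
    -(t * (ddψ - n ^ 2 / 4 * ψ) + t ^ 2 * (K * ((s - ε) ^ 2 - (n / 2 + 1) ^ 2) * κ)
      - a * ((s - ε) ^ 2 - (n / 2 - 1) ^ 2) * κ + 2 * K * κ)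
    ≤ (n ^ 2 / 4 - s ^ 2) * (t * ψ + K * t ^ 2 * κ - a * κ)
      + b * max (t * ψ + K * t ^ 2 * κ - a * κ) 0 := by
  have hK : 0 < K := by nlinarith
  have h1 : t * (-ddψ + s ^ 2 * ψ + H * κ) ≤ t * (b * max ψ 0) := mul_le_mul_of_nonneg_left hode ht0
  have h2 : K * κ * t ^ 2 * (n + 1 + 2 * s * ε - ε ^ 2) ≤ t * H * κ := by
    rw [hH]
    have q1 : t ^ 2 ≤ t := by nlinarith
    have q2 : n + 1 + 2 * s * ε - ε ^ 2 ≤ n + 1 + 2 * s := by nlinarith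
    have q3 : t ^ 2 * (n + 1 + 2 * s * ε - ε ^ 2) ≤ t * (n + 1 + 2 * s) := by
      apply mul_le_mul q1 q2 _ ht0
      nlinarith
    have := mul_le_mul_of_nonneg_left q3 (show 0 ≤ K * κ by positivity)
    linarith
  have h3 : a * κ * (n - 1 - 2 * s * ε + ε ^ 2) ≤ K * κ := by
    have : a * (n - 1 - 2 * s * ε + ε ^ 2) ≤ a * n := by
      apply mul_le_mul_of_nonneg_left _ ha.le
      nlinarith [mul_nonneg hs hε.le]
    have := mul_le_mul_of_nonneg_right (this.trans hK1) hκ.le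
    linarith
  have h4 : t * (b * max ψ 0) - K * κ ≤ b * max (t * ψ + K * t ^ 2 * κ - a * κ) 0 := by
    rcases le_total ψ 0 with hψ | hψ
    · rw [max_eq_right hψ]
      have : 0 ≤ b * max (t * ψ + K * t ^ 2 * κ - a * κ) 0 := by positivity
      nlinarith
    · rw [max_eq_left hψ]
      have q1 := mul_le_mul_of_nonneg_left (le_max_left (t * ψ + K * t ^ 2 * κ - a * κ) 0) hb0
      have q2 : b * (a * κ) ≤ K * κ := by
        have : b * a ≤ bm * a := by gcongr
        have := mul_le_mul_of_nonneg_right (this.trans (show bm * a ≤ K by linarith)) hκ.le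
        linarith
      have q3 : 0 ≤ b * (K * t ^ 2 * κ) := by positivity
      linarith
  nlinarith

set_option maxHeartbeats 3000000 in
lemma testfun {N : ℕ} (hN : 2 ≤ N) {Ω : Set (Euc N)} (hΩ : IsOpen Ω) (e : Euc N) (he : ‖e‖ = 1)
    (A r0 : ℝ) (hA : 0 < A) (hr0 : 0 < r0)
    (hgeo : ∀ x : Euc N, 0 < ‖x‖ → ‖x‖ < r0 → A * ‖x‖ ^ 2 < ⟪e, x⟫ → x ∈ Ω)
    (s Q : ℝ) (hs : 0 ≤ s) (hQ : 1 < Q) (hsN : s < (N : ℝ) / 2 - 1)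
    (hQN : 2 * Q + ((N : ℝ) / 2 - 1 + s) ≤ N) :
    ∃ V : Set (Euc N), IsOpen V ∧ V.Nonempty ∧ ∃ m > 0, ∀ η > 0, ∃ (φ : Euc N → ℝ) (g β : ℝ),
      IsTestFun Ω φ ∧ (∀ x, 0 ≤ φ x) ∧ (∀ x ∈ V, m ≤ φ x) ∧ 0 < g ∧ 0 < β ∧ g ≤ η * β ∧
      (∀ x, φ x ≠ 0 → ‖x‖ ≤ 1) ∧
      ∀ x, ∃ B, 0 ≤ B ∧
        -(lap φ x) - ((N : ℝ) ^ 2 / 4 - s ^ 2) * ‖x‖ ^ (-2 : ℝ) * φ x ≤ B * φ x ∧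
        B ^ Q * φ x ≤ 2 * g * ‖x‖ ^ (β - N) := by
  obtain ⟨ε, bm, hε, hε1, hbm, hprof⟩ := profile s Q hs hQ
  obtain ⟨n, hn⟩ : ∃ n : ℝ, n = N := ⟨_, rfl⟩
  have hn2 : 2 ≤ n := by rw [hn]; exact_mod_cast hN
  obtain ⟨a, ha⟩ : ∃ a : ℝ, a = A + 1 := ⟨_, rfl⟩
  have ha0 : 0 < a := by linarith
  obtain ⟨K, hK⟩ : ∃ K : ℝ, K = a * (n + bm + 4) := ⟨_, rfl⟩
  have hK0 : 0 < K := by rw [hK]; positivity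
  have hK1 : a * n ≤ K := by rw [hK]; gcongr; linarith
  have hK2 : a * bm ≤ K := by rw [hK]; gcongr; linarith
  have hK3 : a * 4 ≤ K := by rw [hK]; gcongr; linarith
  obtain ⟨H, hH⟩ : ∃ H : ℝ, H = K * (n + 1 + 2 * s) := ⟨_, rfl⟩
  obtain ⟨τ, t1, t2, m, hτ0, hτt1, ht12, hm, hη⟩ := hprof K H (max 0 (1 - Real.log r0)) hK0
    (by rw [hH]; positivity) (le_max_left _ _)
  have hτnn : 0 ≤ τ := (le_max_left _ _).trans hτ0
  have hτr : Real.exp (-τ) < r0 := by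
    rw [← Real.lt_log_iff_exp_lt hr0]
    linarith [(le_max_right _ _).trans hτ0]
  refine ⟨{x | ‖x‖ < Real.exp (-t1)} ∩ ({x | Real.exp (-t2) < ‖x‖} ∩ {x | ‖x‖ / 2 < ⟪e, x⟫}),
    ?_, ?_, m / 2, by positivity, ?_⟩
  · refine (isOpen_lt (by fun_prop) (by fun_prop)).inter
      ((isOpen_lt (by fun_prop) (by fun_prop)).inter (isOpen_lt (by fun_prop) (by fun_prop)))
  · refine ⟨Real.exp (-((t1 + t2)/2)) • e, ?_⟩
    have h1 : ‖Real.exp (-((t1 + t2)/2)) • e‖ = Real.exp (-((t1 + t2)/2)) := by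
      rw [norm_smul, he, mul_one, Real.norm_eq_abs, abs_of_pos (Real.exp_pos _)]
    refine ⟨?_, ?_, ?_⟩
    · show ‖_‖ < _
      rw [h1, Real.exp_lt_exp]; linarith
    · show _ < ‖_‖
      rw [h1, Real.exp_lt_exp]; linarith
    · show ‖_‖ / 2 < _
      rw [h1, inner_smul_right, real_inner_self_eq_norm_sq, he]
      have := Real.exp_pos (-((t1 + t2)/2))
      linarith
  intro η hηpos
  obtain ⟨ψ, dψ, ddψ, b, τ1, g, β, hp, hpm⟩ := hη η hηpos
  set R : Set (Euc N) := {x | Real.exp (-τ1) ≤ ‖x‖} ∩ ({x | ‖x‖ ≤ Real.exp (-τ)} ∩ {x | 0 ≤ ⟪e, x⟫})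
    with hRdef
  have hRc : IsCompact R := by
    apply Metric.isCompact_of_isClosed_isBounded
    · exact (isClosed_le (by fun_prop) (by fun_prop)).inter
        ((isClosed_le (by fun_prop) (by fun_prop)).inter (isClosed_le (by fun_prop) (by fun_prop)))
    · apply (Metric.isBounded_closedBall (x := (0 : Euc N)) (r := Real.exp (-τ))).subset
      intro x hx
      simpa using hx.2.1
  have hR0 : ∀ x ∈ R, x ≠ 0 := by
    rintro x hx rfl
    have h1 : Real.exp (-τ1) ≤ ‖(0 : Euc N)‖ := hx.1
    rw [norm_zero] at h1
    linarith [Real.exp_pos (-τ1)]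
  have hRτ : ∀ x ∈ R, τ ≤ tau x ∧ tau x ≤ τ1 := by
    intro x hx
    have h1 : Real.exp (-τ1) ≤ ‖x‖ := hx.1
    have h2 : ‖x‖ ≤ Real.exp (-τ) := hx.2.1
    rw [← exp_neg_tau (hR0 x hx), Real.exp_le_exp] at h1 h2
    constructor <;> linarith
  have hRt : ∀ x ∈ R, 0 ≤ ⟪e, x⟫ * Real.exp (tau x) ∧ ⟪e, x⟫ * Real.exp (tau x) ≤ 1 := by
    intro x hx
    refine ⟨mul_nonneg hx.2.2 (Real.exp_pos _).le, ?_⟩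
    rw [exp_tau (hR0 x hx)]
    have h1 := real_inner_le_norm e x
    rw [he, one_mul] at h1
    have : 0 < ‖x‖ := norm_pos_iff.2 (hR0 x hx)
    rw [← div_eq_mul_inv, div_le_one this]; exact h1
  obtain ⟨a2, ha2⟩ : ∃ a2, a2 = n / 2 + 1 + s - ε := ⟨_, rfl⟩
  obtain ⟨a3, ha3⟩ : ∃ a3, a3 = n / 2 - 1 + s - ε := ⟨_, rfl⟩
  set p1 : ℝ → ℝ := fun t => Real.exp (n / 2 * t) * ψ t with hp1
  set p2 : ℝ → ℝ := fun t => K * Real.exp (a2 * t) with hp2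
  set p3 : ℝ → ℝ := fun t => a * Real.exp (a3 * t) with hp3
  set d1 : ℝ → ℝ := fun t => Real.exp (n / 2 * t) * (dψ t + n / 2 * ψ t) with hd1
  set d2 : ℝ → ℝ := fun t => K * a2 * Real.exp (a2 * t) with hd2
  set d3 : ℝ → ℝ := fun t => a * a3 * Real.exp (a3 * t) with hd3
  set c1 : ℝ → ℝ := fun t => Real.exp (n / 2 * t) * ((ddψ t + n / 2 * dψ t) + n / 2 * (dψ t + n / 2 * ψ t)) with hc1
  set c2 : ℝ → ℝ := fun t => K * a2 * a2 * Real.exp (a2 * t) with hc2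
  set c3 : ℝ → ℝ := fun t => a * a3 * a3 * Real.exp (a3 * t) with hc3
  have q1 : ∀ t, HasDerivAt p1 (d1 t) t := fun t => expψ_hasDerivAt _ t (hp.d1 t)
  have q2 : ∀ t, HasDerivAt p2 (d2 t) t := fun t => expc_hasDerivAt _ _ t
  have q3 : ∀ t, HasDerivAt p3 (d3 t) t := fun t => expc_hasDerivAt _ _ t
  have r1 : ∀ t, HasDerivAt d1 (c1 t) t := fun t =>
    expψ_hasDerivAt _ t ((hp.d2 t).add ((hp.d1 t).const_mul (n / 2)))
  have r2 : ∀ t, HasDerivAt d2 (c2 t) t := fun t => expc_hasDerivAt _ _ t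
  have r3 : ∀ t, HasDerivAt d3 (c3 t) t := fun t => expc_hasDerivAt _ _ t
  have hp1s : ContDiff ℝ (⊤ : ℕ∞) p1 := by have := hp.smooth; fun_prop
  have hp2s : ContDiff ℝ (⊤ : ℕ∞) p2 := by fun_prop
  have hp3s : ContDiff ℝ (⊤ : ℕ∞) p3 := by fun_prop
  -- formula for W
  have hWform : ∀ x ∈ R, Wf e p1 p2 p3 x = Real.exp ((n / 2 - 1) * tau x) *
      ((⟪e, x⟫ * Real.exp (tau x)) * ψ (tau x) + K * (⟪e, x⟫ * Real.exp (tau x)) ^ 2 *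
        Real.exp ((s - ε) * tau x) - a * Real.exp ((s - ε) * tau x)) := by
    intro x hx
    have k1 : Real.exp (n / 2 * tau x) = Real.exp ((n / 2 - 1) * tau x) * Real.exp (tau x) := by
      rw [← Real.exp_add]; ring_nf
    have k2 : Real.exp (a2 * tau x) = Real.exp ((n / 2 - 1) * tau x) * Real.exp (tau x) ^ 2 *
        Real.exp ((s - ε) * tau x) := by
      rw [← Real.exp_nat_mul, ← Real.exp_add, ← Real.exp_add, ha2]; push_cast; ring_nf
    have k3 : Real.exp (a3 * tau x) = Real.exp ((n / 2 - 1) * tau x) *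
        Real.exp ((s - ε) * tau x) := by
      rw [← Real.exp_add, ha3]; ring_nf
    simp only [Wf, hp1, hp2, hp3, k1, k2, k3]
    ring
  have hWle : ∀ x ∈ R, Wf e p1 p2 p3 x ≤ Real.exp ((n / 2 - 1) * tau x) *
      ((⟪e, x⟫ * Real.exp (tau x)) * (ψ (tau x) + K * Real.exp ((s - ε) * tau x))
        - a * Real.exp ((s - ε) * tau x)) := by
    intro x hx
    rw [hWform x hx]
    obtain ⟨h1, h2⟩ := hRt x hx
    have : (⟪e, x⟫ * Real.exp (tau x)) ^ 2 ≤ ⟪e, x⟫ * Real.exp (tau x) := by nlinarith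
    have h3 := mul_le_mul_of_nonneg_left this
      (show 0 ≤ K * Real.exp ((s - ε) * tau x) by positivity)
    apply mul_le_mul_of_nonneg_left _ (Real.exp_pos _).le
    linarith
  obtain ⟨δ0, hδ0, hcut⟩ := cutoff (Ω := Ω) hΩ hRc (Wf e p1 p2 p3) (Gf e p1 p2 d1 d2 d3)
    (fun x => (⟪e, x⟫ * (c1 (tau x) - N * d1 (tau x)) + ⟪e, x⟫ ^ 2 * (c2 (tau x) - (N + 2) * d2 (tau x))
        - (c3 (tau x) - (N - 2) * d3 (tau x))) * (‖x‖ ^ 2)⁻¹ + 2 * p2 (tau x))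
    (fun x hx => Wf_contDiffAt e hp1s hp2s hp3s (hR0 x hx))
    (fun x hx => Wf_hasFDerivAt e q1 q2 q3 (hR0 x hx))
    (fun x hx => Gf_hasFDerivAt e he q1 q2 r1 r2 r3 (hR0 x hx)) (by
      intro x hx hcase
      refine (hWle x hx).trans_lt ?_
      obtain ⟨h1, h2⟩ := hRt x hx
      obtain ⟨h3, h4⟩ := hRτ x hx
      have hκ := Real.exp_pos ((s - ε) * tau x)
      apply mul_neg_of_pos_of_neg (Real.exp_pos _)
      rcases hcase with hcase | hcase
      · have hx0 : Real.exp (-τ1) ≥ ‖x‖ ∨ ‖x‖ ≥ Real.exp (-τ) ∨ ⟪e, x⟫ ≤ 0 := by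
          by_contra! hcon
          apply hcase
          rw [mem_interior]
          refine ⟨{x | Real.exp (-τ1) < ‖x‖} ∩ ({x | ‖x‖ < Real.exp (-τ)} ∩ {x | 0 < ⟪e, x⟫}),
            ?_, ?_, ⟨hcon.1, hcon.2.1, hcon.2.2⟩⟩
          · rintro y ⟨hy1, hy2, hy3⟩
            exact ⟨(le_of_lt hy1 : Real.exp (-τ1) ≤ ‖y‖), (le_of_lt hy2 : ‖y‖ ≤ Real.exp (-τ)), (le_of_lt hy3 : (0:ℝ) ≤ ⟪e, y⟫)⟩
          · exact (isOpen_lt (by fun_prop) (by fun_prop)).inter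
              ((isOpen_lt (by fun_prop) (by fun_prop)).inter (isOpen_lt (by fun_prop) (by fun_prop)))
        rcases hx0 with hx0 | hx0 | hx0
        · rw [ge_iff_le, ← exp_neg_tau (hR0 x hx), Real.exp_le_exp] at hx0
          have : tau x = τ1 := by linarith
          rw [this] at h1 h2 hκ ⊢
          have := mul_nonneg h1 (neg_nonneg.2 hp.right)
          nlinarith
        · rw [ge_iff_le, ← exp_neg_tau (hR0 x hx), Real.exp_le_exp] at hx0
          have : tau x = τ := by linarith
          rw [this] at h1 h2 hκ ⊢
          have := mul_nonneg h1 (neg_nonneg.2 hp.left)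
          nlinarith
        · have : ⟪e, x⟫ = 0 := le_antisymm hx0 hx.2.2
          rw [this]
          nlinarith
      · have hx1 : ‖x‖ ≤ Real.exp (-τ) := hx.2.1
        have hxp : 0 < ‖x‖ := norm_pos_iff.2 (hR0 x hx)
        have h5 : ⟪e, x⟫ ≤ A * ‖x‖ ^ 2 := by
          by_contra! hcon
          exact hcase (hgeo x hxp (by linarith) hcon)
        have h6 := hp.top (tau x) h3 h4
        have h7 := mul_le_mul_of_nonneg_left h6 h1
        have h8 : ⟪e, x⟫ * Real.exp (tau x) * Real.exp ((s - ε + 1) * tau x) ≤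
            A * Real.exp ((s - ε) * tau x) := by
          have k : Real.exp ((s - ε + 1) * tau x) = Real.exp ((s - ε) * tau x) * Real.exp (tau x) := by
            rw [← Real.exp_add]; ring_nf
          rw [k, exp_tau (hR0 x hx)]
          have : ⟪e, x⟫ * ‖x‖⁻¹ * ‖x‖⁻¹ ≤ A := by
            rw [← div_eq_mul_inv, ← div_eq_mul_inv, div_div, div_le_iff₀ (by positivity)]
            linarith
          calc _ = (⟪e, x⟫ * ‖x‖⁻¹ * ‖x‖⁻¹) * Real.exp ((s - ε) * tau x) := by ring
            _ ≤ _ := by gcongr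
        nlinarith)
  have hβ := hp.β0
  have hg := hp.g0
  obtain ⟨δ, hδ, hδle, hδg⟩ : ∃ δ, 0 < δ ∧ δ ≤ δ0 ∧ bm ^ Q * δ ≤ g * Real.exp (-(β * τ1)) := by
    have hbQ : 0 < bm ^ Q := by positivity
    refine ⟨min δ0 (g * Real.exp (-(β * τ1)) / bm ^ Q), by positivity, min_le_left _ _, ?_⟩
    rw [← le_div_iff₀' hbQ]; exact min_le_right _ _
  obtain ⟨φ, hφt, hφ0, hφW, hφx⟩ := hcut δ hδ hδle
  refine ⟨φ, g, β, hφt, hφ0, ?_, hg, hβ, hp.gη, ?_, ?_⟩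
  · rintro x ⟨hx1, hx2, hx3⟩
    change ‖x‖ < Real.exp (-t1) at hx1
    change Real.exp (-t2) < ‖x‖ at hx2
    change ‖x‖ / 2 < ⟪e, x⟫ at hx3
    have hxp : 0 < ‖x‖ := (Real.exp_pos _).trans hx2
    have hxR : x ∈ R := by
      refine ⟨?_, ?_, ?_⟩
      · show _ ≤ ‖x‖
        refine le_trans ?_ hx2.le
        rw [Real.exp_le_exp]; linarith [hp.ht]
      · show ‖x‖ ≤ _
        refine hx1.le.trans ?_
        rw [Real.exp_le_exp]; linarith
      · show 0 ≤ ⟪e, x⟫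
        linarith
    have hx0 := hR0 x hxR
    refine le_trans ?_ (hφW x hxR)
    rw [hWform x hxR]
    rw [← exp_neg_tau hx0, Real.exp_lt_exp] at hx1 hx2
    have h1 := hpm (tau x) (by linarith) (by linarith)
    obtain ⟨h2, h3⟩ := hRt x hxR
    have h4 : 1/2 ≤ ⟪e, x⟫ * Real.exp (tau x) := by
      rw [exp_tau hx0, ← div_eq_mul_inv, le_div_iff₀ hxp]; linarith
    have h5 : 1 ≤ Real.exp ((n / 2 - 1) * tau x) := by
      apply Real.one_le_exp
      apply mul_nonneg <;> linarith
    have h6 := Real.exp_pos ((s - ε) * tau x)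
    generalize ⟪e, x⟫ * Real.exp (tau x) = t at *
    have h7 : a ≤ K * t ^ 2 := by
      have : 1/4 ≤ t ^ 2 := by nlinarith
      nlinarith
    have h8 : a * Real.exp ((s - ε) * tau x) ≤ K * t ^ 2 * Real.exp ((s - ε) * tau x) := by gcongr
    have h9 : m / 2 ≤ t * ψ (tau x) := by nlinarith
    nlinarith
  · intro x hx
    rcases hφx x with h | h
    · exact absurd h.2 hx
    · have : ‖x‖ ≤ Real.exp (-τ) := h.1.2.1
      exact this.trans (Real.exp_le_one_iff.2 (by linarith))
  · intro x
    rcases hφx x with ⟨h1, h2⟩ | ⟨hxR, -, hle, d, hd0, hdW, hdL⟩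
    · refine ⟨0, le_rfl, by simp [h1, h2], ?_⟩
      rw [h2, mul_zero]; positivity
    · have hx0 := hR0 x hxR
      have hxp : 0 < ‖x‖ := norm_pos_iff.2 hx0
      obtain ⟨h3, h4⟩ := hRτ x hxR
      obtain ⟨h1, h2⟩ := hRt x hxR
      have hτx : 0 ≤ tau x := by linarith
      have hb0 := hp.b0 _ h3 h4
      have hb1 := hp.b1 _ h3 h4
      have hE : Real.exp (tau x) ^ 2 = ‖x‖ ^ (-2 : ℝ) := by
        rw [exp_tau hx0, Real.rpow_neg hxp.le]; norm_num
      refine ⟨b (tau x) * Real.exp (tau x) ^ 2, by positivity, ?_, ?_⟩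
      · rw [← hE]
        have key := alg_ineq (n := n) h1 h2 (Real.exp_pos ((s - ε) * tau x)) hs hε hε1 hn2 ha0 hK1 hK2 hH
          hb0 hb1 (hp.ode _ h3 h4)
        have k1 : Real.exp (n / 2 * tau x) = Real.exp ((n / 2 - 1) * tau x) * Real.exp (tau x) := by
          rw [← Real.exp_add]; ring_nf
        have k2 : Real.exp (a2 * tau x) = Real.exp ((n / 2 - 1) * tau x) * Real.exp (tau x) ^ 2 *
            Real.exp ((s - ε) * tau x) := by
          rw [← Real.exp_nat_mul, ← Real.exp_add, ← Real.exp_add, ha2]; push_cast; ring_nf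
        have k3 : Real.exp (a3 * tau x) = Real.exp ((n / 2 - 1) * tau x) *
            Real.exp ((s - ε) * tau x) := by
          rw [← Real.exp_add, ha3]; ring_nf
        have k4 : (‖x‖ ^ 2)⁻¹ = Real.exp (tau x) ^ 2 := by rw [exp_tau hx0, inv_pow]
        have hWx := hWform x hxR
        have hL : (⟪e, x⟫ * (c1 (tau x) - N * d1 (tau x)) + ⟪e, x⟫ ^ 2 * (c2 (tau x) - (N + 2) * d2 (tau x))
            - (c3 (tau x) - (N - 2) * d3 (tau x))) * (‖x‖ ^ 2)⁻¹ + 2 * p2 (tau x)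
            = Real.exp (tau x) ^ 2 * Real.exp ((n / 2 - 1) * tau x) *
            ((⟪e, x⟫ * Real.exp (tau x)) * (ddψ (tau x) - n ^ 2 / 4 * ψ (tau x)) +
            (⟪e, x⟫ * Real.exp (tau x)) ^ 2 * (K * ((s - ε) ^ 2 - (n / 2 + 1) ^ 2) * Real.exp ((s - ε) * tau x))
            - a * ((s - ε) ^ 2 - (n / 2 - 1) ^ 2) * Real.exp ((s - ε) * tau x)
            + 2 * K * Real.exp ((s - ε) * tau x)) := by
          rw [k4, ← hn]
          simp only [hp2, hd1, hd2, hd3, hc1, hc2, hc3, k1, k2, k3]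
          rw [ha2, ha3]
          ring
        rw [hL] at hdL
        rw [← hn]
        have hP := Real.exp_pos ((n / 2 - 1) * tau x)
        have hEp : 0 < Real.exp (tau x) ^ 2 := by positivity
        have hc0 : 0 ≤ n ^ 2 / 4 - s ^ 2 := by
          have : s < n / 2 - 1 := by rw [hn]; exact hsN
          have h5 : s ^ 2 ≤ (n / 2) ^ 2 := pow_le_pow_left₀ hs (by linarith) 2
          linarith
        have hmax : max (Wf e p1 p2 p3 x) 0 = Real.exp ((n / 2 - 1) * tau x) * max
          ((⟪e, x⟫ * Real.exp (tau x)) * ψ (tau x) + K * (⟪e, x⟫ * Real.exp (tau x)) ^ 2 *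
          Real.exp ((s - ε) * tau x) - a * Real.exp ((s - ε) * tau x)) 0 := by
          rw [mul_max_of_nonneg _ _ hP.le, mul_zero, hWx]
        have hdmax : d * max (Wf e p1 p2 p3 x) 0 ≤ φ x := by
          rw [mul_max_of_nonneg _ _ hd0, mul_zero]; exact max_le hdW (hφ0 x)
        have key2 := mul_le_mul_of_nonneg_left key
          (show 0 ≤ d * (Real.exp (tau x) ^ 2 * Real.exp ((n / 2 - 1) * tau x)) by positivity)
        have m1 := mul_le_mul_of_nonneg_left hdW (mul_nonneg hc0 hEp.le)
        have m2 := mul_le_mul_of_nonneg_left hdmax (mul_nonneg hb0 hEp.le)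
        rw [hWx] at m1
        rw [hmax] at m2
        linarith
      · have hW2 : max (Wf e p1 p2 p3 x) 0 ≤ Real.exp ((n / 2 - 1) * tau x) *
            max (ψ (tau x) + K * Real.exp ((s - ε) * tau x)) 0 := by
          apply max_le _ (by positivity)
          refine (hWle x hxR).trans ?_
          apply mul_le_mul_of_nonneg_left _ (Real.exp_pos _).le
          have m0 : 0 ≤ max (ψ (tau x) + K * Real.exp ((s - ε) * tau x)) 0 := le_max_right _ _
          have m1 := mul_le_mul_of_nonneg_left
            (le_max_left (ψ (tau x) + K * Real.exp ((s - ε) * tau x)) 0) h1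
          have m2 := mul_le_mul_of_nonneg_right h2 m0
          have m3 : 0 < a * Real.exp ((s - ε) * tau x) := by positivity
          linarith
        have hsm := hp.small _ h3 h4
        have hbQ : 0 ≤ b (tau x) ^ Q := Real.rpow_nonneg hb0 Q
        have e1 : b (tau x) ^ Q * max (Wf e p1 p2 p3 x) 0 ≤
            g * Real.exp ((n / 2 - 1 + s - β) * tau x) := by
          have m1 := mul_le_mul_of_nonneg_left hW2 hbQ
          have m2 := mul_le_mul_of_nonneg_left hsm
            (show 0 ≤ Real.exp ((n / 2 - 1) * tau x) * Real.exp (s * tau x) by positivity)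
          have m3 : Real.exp ((n / 2 - 1) * tau x) * Real.exp (s * tau x) * (g * Real.exp (-(β * tau x)))
            = g * Real.exp ((n / 2 - 1 + s - β) * tau x) := by
            rw [show (n / 2 - 1 + s - β) * tau x = (n / 2 - 1) * tau x + s * tau x + -(β * tau x) by ring,
              Real.exp_add, Real.exp_add]; ring
          have m4 : Real.exp (s * tau x) * Real.exp (-(s * tau x)) = 1 := by
            rw [← Real.exp_add]; simp
          rw [m3] at m2
          refine le_trans m1 (le_trans (le_of_eq ?_) m2)
          calc _ = b (tau x) ^ Q * (Real.exp ((n / 2 - 1) * tau x) *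
              max (ψ (tau x) + K * Real.exp ((s - ε) * tau x)) 0) *
              (Real.exp (s * tau x) * Real.exp (-(s * tau x))) := by rw [m4, mul_one]
            _ = _ := by ring
        have e2 : b (tau x) ^ Q * δ ≤ g * Real.exp ((n / 2 - 1 + s - β) * tau x) := by
          calc _ ≤ bm ^ Q * δ := by
                gcongr
              _ ≤ _ := hδg
              _ ≤ _ := by
                gcongr
                have : β * tau x ≤ β * τ1 := by gcongr
                have : 0 ≤ (n / 2 - 1 + s) * tau x := by apply mul_nonneg <;> linarith
                linarith
        have e3 : b (tau x) ^ Q * φ x ≤ 2 * g * Real.exp ((n / 2 - 1 + s - β) * tau x) := by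
          have := mul_le_mul_of_nonneg_left hle hbQ
          linarith
        have e4 : (b (tau x) * Real.exp (tau x) ^ 2) ^ Q = b (tau x) ^ Q * Real.exp (2 * Q * tau x) := by
          rw [Real.mul_rpow hb0 (by positivity), ← Real.exp_nat_mul, ← Real.exp_mul]
          push_cast; ring_nf
        have e5 : ‖x‖ ^ (β - N) = Real.exp ((n - β) * tau x) := by
          rw [← hn, ← exp_neg_tau hx0, ← Real.exp_mul]; ring_nf
        rw [e4, e5]
        calc _ = (b (tau x) ^ Q * φ x) * Real.exp (2 * Q * tau x) := by ring
          _ ≤ (2 * g * Real.exp ((n / 2 - 1 + s - β) * tau x)) * Real.exp (2 * Q * tau x) := by gcongr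
          _ = 2 * g * Real.exp ((n / 2 - 1 + s - β) * tau x + 2 * Q * tau x) := by
            rw [Real.exp_add]; ring
          _ ≤ _ := by
            gcongr
            rw [← hn] at hQN
            have := mul_le_mul_of_nonneg_right hQN hτx
            linarith

lemma geo {N : ℕ} {Ω : Set (Euc N)} (hΩ : IsSmoothDomain Ω) (h0 : (0 : Euc N) ∈ frontier Ω) :
    ∃ e : Euc N, ‖e‖ = 1 ∧ ∃ A r0 : ℝ, 0 < A ∧ 0 < r0 ∧
      ∀ x : Euc N, 0 < ‖x‖ → ‖x‖ < r0 → A * ‖x‖ ^ 2 < ⟪e, x⟫ → x ∈ Ω := by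
  obtain ⟨U, f, hU, h0U, hf, hdf, hΩU, hfU⟩ := hΩ.2.2.2 0 h0
  have hf0 : f 0 = 0 := by
    have : (0 : Euc N) ∈ frontier Ω ∩ U := ⟨h0, h0U⟩
    rw [hfU] at this; exact this.2
  set v : Euc N := (InnerProductSpace.toDual ℝ (Euc N)).symm (fderiv ℝ f 0) with hv
  have hvx : ∀ x, fderiv ℝ f 0 x = ⟪v, x⟫ := by
    intro x; rw [hv, InnerProductSpace.toDual_symm_apply]
  have hv0 : 0 < ‖v‖ := by
    rw [norm_pos_iff]
    intro h
    apply hdf 0 h0U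
    rw [hv] at h
    simpa using h
  have hdiff : Differentiable ℝ f := hf.differentiable (by simp)
  have hC1 : ContDiff ℝ 1 (fderiv ℝ f) := (contDiff_infty.1 hf 2).fderiv_right (by norm_num)
  obtain ⟨M, t, ht, hM⟩ := hC1.contDiffAt.exists_lipschitzOnWith (x := (0 : Euc N))
  obtain ⟨r, hr, hrU⟩ := Metric.mem_nhds_iff.1 (Filter.inter_mem ht (hU.mem_nhds h0U))
  have h0t : (0 : Euc N) ∈ t := (hrU (mem_ball_self hr)).1
  refine ⟨-(‖v‖⁻¹ • v), ?_, (M + 1) / ‖v‖, r, by positivity, hr, ?_⟩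
  · rw [norm_neg, norm_smul, norm_inv, norm_norm, inv_mul_cancel₀ hv0.ne']
  · intro x hx0 hxr hx
    have hb : ‖f x - f 0 - fderiv ℝ f 0 (x - 0)‖ ≤ (M * ‖x‖) * ‖x - 0‖ := by
      apply (convex_closedBall (0 : Euc N) ‖x‖).norm_image_sub_le_of_norm_fderiv_le'
        (fun y _ => hdiff y)
      · intro y hy
        have hy' : ‖y‖ ≤ ‖x‖ := by simpa using hy
        have hyt : y ∈ t := (hrU (by simpa using hy'.trans_lt hxr)).1
        have := hM.dist_le_mul y hyt 0 h0t
        rw [dist_eq_norm, dist_eq_norm, sub_zero] at this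
        refine this.trans ?_
        gcongr
      · simp
      · simp
    rw [hf0, sub_zero, sub_zero, hvx] at hb
    have hfx := (abs_le.1 hb).2
    have hxU : x ∈ U := (hrU (by simpa using hxr)).2
    have : x ∈ Ω ∩ U := by
      rw [hΩU]
      refine ⟨hxU, ?_⟩
      rw [inner_neg_left, real_inner_smul_left, div_mul_eq_mul_div, div_lt_iff₀ hv0] at hx
      have h3 : -(‖v‖⁻¹ * ⟪v, x⟫) * ‖v‖ = - ⟪v, x⟫ := by field_simp
      rw [h3] at hx
      have : 0 ≤ ‖x‖ ^ 2 := by positivity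
      nlinarith
    exact this.1

lemma radial_int {N : ℕ} (hN : 1 ≤ N) : ∃ C : ℝ, 0 ≤ C ∧ ∀ β : ℝ, 0 < β →
    Integrable (fun x : Euc N => (Set.Iic (1:ℝ)).indicator (fun r => r ^ (β - N)) ‖x‖) ∧
    ∫ x : Euc N, (Set.Iic (1:ℝ)).indicator (fun r => r ^ (β - N)) ‖x‖ = C / β := by
  have : Nonempty (Fin N) := ⟨⟨0, hN⟩⟩
  have : Nontrivial (Euc N) := by infer_instance
  refine ⟨N * (volume : Measure (Euc N)).real (ball 0 1), by positivity, fun β hβ => ?_⟩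
  have hfun : ∀ y ∈ Set.Ioi (0:ℝ), y ^ (Module.finrank ℝ (Euc N) - 1) •
      (Set.Iic (1:ℝ)).indicator (fun r => r ^ (β - N)) y =
      (Set.Iic (1:ℝ)).indicator (fun r => r ^ (β - 1)) y := by
    intro y hy
    have hy : 0 < y := hy
    rw [finrank_euclideanSpace_fin]
    by_cases h : y ∈ Set.Iic (1:ℝ)
    · rw [Set.indicator_of_mem h, Set.indicator_of_mem h, smul_eq_mul, ← Real.rpow_natCast,
        ← Real.rpow_add hy, Nat.cast_sub hN]
      congr 1; push_cast; ring
    · rw [Set.indicator_of_notMem h, Set.indicator_of_notMem h, smul_zero]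
  have hhin : IntervalIntegrable (fun x : ℝ => x ^ (β - 1)) volume 0 1 :=
    intervalIntegral.intervalIntegrable_rpow' (by linarith)
  rw [intervalIntegrable_iff_integrableOn_Ioc_of_le zero_le_one] at hhin
  constructor
  · rw [integrable_fun_norm_addHaar volume, integrableOn_congr_fun hfun measurableSet_Ioi,
      IntegrableOn, integrable_indicator_iff measurableSet_Iic, IntegrableOn,
      Measure.restrict_restrict measurableSet_Iic, Set.inter_comm, Set.Ioi_inter_Iic]
    exact hhin
  · rw [integral_fun_norm_addHaar volume, setIntegral_congr_fun measurableSet_Ioi hfun,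
      integral_indicator measurableSet_Iic,
      Measure.restrict_restrict measurableSet_Iic, Set.inter_comm, Set.Ioi_inter_Iic,
      ← intervalIntegral.integral_of_le zero_le_one, integral_rpow (Or.inl (by linarith)),
      finrank_euclideanSpace_fin]
    rw [sub_add_cancel, Real.one_rpow, Real.zero_rpow hβ.ne']
    simp
    ring

lemma int_mul {N : ℕ} {Ω K : Set (Euc N)} {w ψ : Euc N → ℝ} (hw : LocallyIntegrableOn w Ω volume)
    (hψ : Continuous ψ) (hK : IsCompact K) (hKΩ : K ⊆ Ω) (h0 : ∀ x, x ∉ K → ψ x = 0) :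
    Integrable (fun x => w x * ψ x) volume := by
  have h1 : IntegrableOn w K volume := hw.integrableOn_compact_subset hKΩ hK
  have h2 : IntegrableOn (fun x => w x * ψ x) K volume := h1.mul_continuousOn hψ.continuousOn hK
  rwa [integrableOn_iff_integrable_of_support_subset] at h2
  intro x hx
  by_contra h
  exact hx (by simp [h0 x h])

lemma lap_continuous {N : ℕ} {φ : Euc N → ℝ} (h : ContDiff ℝ (⊤ : ℕ∞) φ) : Continuous (lap φ) := by
  have : Continuous (iteratedFDeriv ℝ 2 φ) := (contDiff_infty.1 h 2).continuous_iteratedFDeriv le_rfl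
  unfold lap
  refine continuous_finsetSum _ fun i _ => ?_
  fun_prop

lemma lap_zero {N : ℕ} {φ : Euc N → ℝ} {x : Euc N} (h : x ∉ tsupport φ) : lap φ x = 0 := by
  have h1 : iteratedFDeriv ℝ 2 φ x = 0 := by
    by_contra hne
    exact h (support_iteratedFDeriv_subset 2 hne)
  simp [lap, h1]

lemma test_integrable {N : ℕ} {Ω : Set (Euc N)} {c p : ℝ} {u φ : Euc N → ℝ}
    (huloc : LocallyIntegrableOn u Ω volume)
    (hup : LocallyIntegrableOn (fun x => u x ^ p) Ω volume)
    (hbu : LocallyIntegrableOn (fun x => c * ‖x‖ ^ (-2 : ℝ) * u x) Ω volume)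
    (hφ : IsTestFun Ω φ) : Integrable (fun x => u x ^ p * φ x) volume ∧
      Integrable (fun x => u x * (-(lap φ x) - c * ‖x‖ ^ (-2 : ℝ) * φ x)) volume := by
  obtain ⟨h1, h2, h3⟩ := hφ
  refine ⟨int_mul hup h1.continuous h2 h3 (fun x hx => image_eq_zero_of_notMem_tsupport hx), ?_⟩
  have k1 := int_mul huloc (lap_continuous h1) h2 h3 (fun x hx => lap_zero hx)
  have k2 := int_mul hbu h1.continuous h2 h3 (fun x hx => image_eq_zero_of_notMem_tsupport hx)
  refine (k1.neg.sub k2).congr (ae_of_all _ fun x => ?_)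
  simp
  ring

lemma vanish_ball {N : ℕ} (hN : 3 ≤ N) (Ω : Set (Euc N))
    (hΩ : IsSmoothDomain Ω) (h0 : (0 : Euc N) ∈ frontier Ω)
    (c p : ℝ) (hc1 : (N : ℝ) - 1 < c)
    (hp : 1 + 2 / (((N : ℝ) - 2) / 2 - Real.sqrt ((N : ℝ) ^ 2 / 4 - c)) ≤ p)
    (u : Euc N → ℝ)
    (hu0 : ∀ᵐ x ∂volume, x ∈ Ω → 0 ≤ u x)
    (huloc : LocallyIntegrableOn u (Ω) volume)
    (hup : LocallyIntegrableOn (fun x => u x ^ p) (Ω) volume)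
    (hbu : LocallyIntegrableOn (fun x => c * ‖x‖ ^ (-2 : ℝ) * u x) (Ω) volume)
    (hsuper : ∀ φ : Euc N → ℝ, IsTestFun (Ω) φ → (∀ x, 0 ≤ φ x) →
      ∫ x in Ω, u x ^ p * φ x ≤
        ∫ x in Ω, u x * (-(lap φ x) - c * ‖x‖ ^ (-2 : ℝ) * φ x)) :
    1 < p ∧ ∃ y ∈ Ω, ∃ r > 0, ∀ᵐ x ∂volume, x ∈ ball y r → u x = 0 := by
  obtain ⟨n, hn⟩ : ∃ n : ℝ, n = N := ⟨_, rfl⟩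
  have hn2 : 3 ≤ n := by rw [hn]; exact_mod_cast hN
  rw [← hn] at hc1 hp
  obtain ⟨s, hs⟩ : ∃ s, s = Real.sqrt (n ^ 2 / 4 - c) := ⟨_, rfl⟩
  rw [← hs] at hp
  have hs0 : 0 ≤ s := by rw [hs]; exact Real.sqrt_nonneg _
  have hc0 : n ^ 2 / 4 - s ^ 2 ≤ c := by
    rcases le_total 0 (n ^ 2 / 4 - c) with h | h
    · rw [hs, Real.sq_sqrt h]; linarith
    · nlinarith
  have hsn : s < n / 2 - 1 := by
    rcases hs0.eq_or_lt with h | h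
    · linarith
    · rw [hs, Real.sqrt_lt' (by linarith)]
      nlinarith
  have hα : 0 < (n - 2) / 2 - s := by linarith
  have hp1 : 2 / ((n - 2) / 2 - s) ≤ p - 1 := by linarith
  have hp1' : 0 < p - 1 := lt_of_lt_of_le (by positivity) hp1
  obtain ⟨Q, hQ⟩ : ∃ Q, Q = p / (p - 1) := ⟨_, rfl⟩
  have hpQ : p.HolderConjugate Q := by
    rw [hQ]; exact Real.HolderConjugate.conjExponent (by linarith)
  have hQ1 : 1 < Q := hpQ.symm.lt
  have hQN : 2 * Q + (n / 2 - 1 + s) ≤ n := by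
    have : Q = 1 + 1 / (p - 1) := by rw [hQ]; field_simp; ring
    have h2 : 2 * (1 / (p - 1)) ≤ (n - 2) / 2 - s := by
      rw [div_le_iff₀ hα] at hp1
      rw [mul_one_div, div_le_iff₀ hp1']; linarith
    linarith
  obtain ⟨e, he, A, r0, hA, hr0, hgeo⟩ := geo hΩ h0
  rw [hn] at hsn hQN
  obtain ⟨V, hV, hVne, m, hm, hT⟩ := testfun (by omega) hΩ.1 e he A r0 hA hr0 hgeo s Q hs0 hQ1 hsn hQN
  obtain ⟨C, hC, hCβ⟩ := radial_int (N := N) (by omega)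
  have hVΩ : V ⊆ Ω := by
    obtain ⟨φ, g, β, hφt, hφ0, hφV, -⟩ := hT 1 one_pos
    intro x hx
    apply hφt.2.2
    apply subset_tsupport
    have := hφV x hx
    show φ x ≠ 0
    linarith
  have hΩm : MeasurableSet Ω := hΩ.1.measurableSet
  obtain ⟨y, hy⟩ := hVne
  obtain ⟨r, hr, hrV⟩ := Metric.nhds_basis_closedBall.mem_iff.1 (hV.mem_nhds hy)
  refine ⟨by linarith, y, hVΩ hy, r, hr, ?_⟩
  have hintB : IntegrableOn (fun x => u x ^ p) (closedBall y r) volume :=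
    hup.integrableOn_compact_subset (hrV.trans hVΩ) (isCompact_closedBall y r)
  have hu0r : ∀ᵐ x ∂volume.restrict Ω, 0 ≤ u x := (ae_restrict_iff' hΩm).2 hu0
  have hbound : ∀ η > 0, m * ∫ x in closedBall y r, u x ^ p ≤ 2 * C * η := by
    intro η hη
    obtain ⟨φ, g, β, hφt, hφ0, hφV, hg, hβ, hgβ, hφ1, hB⟩ := hT η hη
    obtain ⟨hi1, hi2⟩ := test_integrable huloc hup hbu hφt
    obtain ⟨hi3, hi3v⟩ := hCβ β hβ
    have hsup := hsuper φ hφt hφ0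
    have hle : ∫ x in Ω, u x * (-(lap φ x) - c * ‖x‖ ^ (-2 : ℝ) * φ x) ≤
        ∫ x in Ω, (p⁻¹ * (u x ^ p * φ x) + Q⁻¹ * (2 * g *
          (Set.Iic (1:ℝ)).indicator (fun r => r ^ (β - N)) ‖x‖)) := by
      apply integral_mono_ae hi2.integrableOn
      · exact ((hi1.const_mul _).add ((hi3.const_mul _).const_mul _)).integrableOn
      · filter_upwards [hu0r] with x hux
        by_cases hφx : φ x = 0
        · obtain ⟨B, hB0, hB1, hB2⟩ := hB x
          have h1 : -(lap φ x) ≤ 0 := by simpa [hφx] using hB1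
          have h2 : 0 ≤ (Set.Iic (1:ℝ)).indicator (fun r => r ^ (β - N)) ‖x‖ :=
            Set.indicator_apply_nonneg fun _ => by positivity
          have hQi : 0 < Q⁻¹ := by positivity
          simp only [hφx, mul_zero, sub_zero, zero_add]
          have : u x * -(lap φ x) ≤ 0 := mul_nonpos_of_nonneg_of_nonpos hux h1
          have : 0 ≤ Q⁻¹ * (2 * g * (Set.Iic (1:ℝ)).indicator (fun r => r ^ (β - N)) ‖x‖) := by positivity
          linarith
        · rw [Set.indicator_of_mem (show ‖x‖ ∈ Set.Iic (1:ℝ) from hφ1 x hφx)]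
          obtain ⟨B, hB0, hB1, hB2⟩ := hB x
          rw [← hn] at hB1
          have hrp : 0 ≤ ‖x‖ ^ (-2 : ℝ) * φ x := mul_nonneg (by positivity) (hφ0 x)
          have h1 : -(lap φ x) - c * ‖x‖ ^ (-2 : ℝ) * φ x ≤ B * φ x := by
            refine le_trans ?_ hB1
            have := mul_le_mul_of_nonneg_right hc0 hrp
            linarith
          have h2 := mul_le_mul_of_nonneg_left h1 hux
          have h3 := mul_le_mul_of_nonneg_right
            (Real.young_inequality_of_nonneg hux hB0 hpQ) (hφ0 x)
          have hQi : 0 ≤ Q⁻¹ := by positivity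
          have h4 := mul_le_mul_of_nonneg_left hB2 hQi
          rw [div_eq_inv_mul, div_eq_inv_mul] at h3
          linarith
    have hsplit : ∫ x in Ω, (p⁻¹ * (u x ^ p * φ x) + Q⁻¹ * (2 * g *
          (Set.Iic (1:ℝ)).indicator (fun r => r ^ (β - N)) ‖x‖)) =
        p⁻¹ * (∫ x in Ω, u x ^ p * φ x) + Q⁻¹ * (2 * g *
          ∫ x in Ω, (Set.Iic (1:ℝ)).indicator (fun r => r ^ (β - N)) ‖x‖) := by
      rw [integral_add (hi1.const_mul _).integrableOn
        ((hi3.const_mul _).const_mul _).integrableOn, integral_const_mul, integral_const_mul,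
        integral_const_mul]
    have h3le : ∫ x in Ω, (Set.Iic (1:ℝ)).indicator (fun r => r ^ (β - N)) ‖x‖ ≤ C / β := by
      rw [← hi3v]
      apply setIntegral_le_integral hi3
      exact ae_of_all _ fun x => Set.indicator_apply_nonneg fun _ => by positivity
    have hfin : ∫ x in Ω, u x ^ p * φ x ≤ 2 * g * (C / β) := by
      rw [hsplit] at hle
      have hpq := hpQ.inv_add_inv_eq_one
      have hQi : 0 < Q⁻¹ := by positivity
      have h5 : Q⁻¹ * (∫ x in Ω, u x ^ p * φ x) ≤ Q⁻¹ * (2 * g * (C / β)) := by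
        have h6 : Q⁻¹ * (2 * g * ∫ x in Ω, (Set.Iic (1:ℝ)).indicator (fun r => r ^ (β - N)) ‖x‖) ≤
          Q⁻¹ * (2 * g * (C / β)) := by gcongr
        have h7 : Q⁻¹ = 1 - p⁻¹ := by linarith
        rw [h7] at hle h6 ⊢
        linarith
      exact le_of_mul_le_mul_left h5 hQi
    have h8 : 2 * g * (C / β) ≤ 2 * C * η := by
      have : g * (C / β) ≤ η * β * (C / β) := by gcongr
      have h9 : η * β * (C / β) = η * C := by field_simp
      linarith
    refine le_trans ?_ (hfin.trans h8)
    rw [← integral_const_mul]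
    calc ∫ x in closedBall y r, m * u x ^ p ≤ ∫ x in closedBall y r, u x ^ p * φ x := by
          apply integral_mono_ae (hintB.const_mul m) hi1.integrableOn
          have : ∀ᵐ x ∂volume.restrict (closedBall y r), 0 ≤ u x :=
            ae_mono (Measure.restrict_mono (hrV.trans hVΩ) le_rfl) hu0r
          filter_upwards [this, ae_restrict_mem measurableSet_closedBall] with x hx hxb
          have h1 := hφV x (hrV hxb)
          have h2 : 0 ≤ u x ^ p := Real.rpow_nonneg hx p
          nlinarith
      _ ≤ _ := by
          apply setIntegral_mono_set hi1.integrableOn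
          · filter_upwards [hu0r] with x hx
            exact mul_nonneg (Real.rpow_nonneg hx p) (hφ0 x)
          · exact (hrV.trans hVΩ).eventuallyLE
  have hz : ∫ x in closedBall y r, u x ^ p ≤ 0 := by
    have : m * ∫ x in closedBall y r, u x ^ p ≤ 0 := by
      apply le_of_forall_pos_le_add
      intro ε hε
      refine (hbound (ε / (2 * C + 1)) (by positivity)).trans ?_
      rw [zero_add, mul_div_assoc', div_le_iff₀ (by positivity)]
      nlinarith
    by_contra! h
    have := mul_pos hm h
    linarith
  have hnn : 0 ≤ᵐ[volume.restrict (closedBall y r)] fun x => u x ^ p := by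
    have : ∀ᵐ x ∂volume.restrict (closedBall y r), 0 ≤ u x :=
      ae_mono (Measure.restrict_mono (hrV.trans hVΩ) le_rfl) hu0r
    filter_upwards [this] with x hx using Real.rpow_nonneg hx p
  have hzero := (setIntegral_eq_zero_iff_of_nonneg_ae hnn hintB).1
    (le_antisymm hz (integral_nonneg_of_ae hnn))
  rw [Filter.EventuallyEq, ae_restrict_iff' measurableSet_closedBall] at hzero
  filter_upwards [hzero, hu0] with x hx hx0 hxb
  have h1 := hx (ball_subset_closedBall hxb)
  have h2 := hx0 (hVΩ (hrV (ball_subset_closedBall hxb)))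
  exact (Real.rpow_eq_zero h2 (by linarith)).1 h1

lemma gauss_grad {N : ℕ} (y : Euc N) (k a : ℝ) (x : Euc N) :
    HasFDerivAt (fun z : Euc N => Real.exp (-k * ‖z - y‖ ^ 2) - a)
      (innerSL ℝ ((-2 * k * Real.exp (-k * ‖x - y‖ ^ 2)) • (x - y))) x := by
  have h1 : HasFDerivAt (fun z : Euc N => z - y) (ContinuousLinearMap.id ℝ (Euc N)) x :=
    (hasFDerivAt_id x).sub_const y
  have h2 := ((h1.norm_sq.const_mul (-k)).exp).sub_const a
  refine HasFDerivAt.congr_fderiv (f := _) h2 ?_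
  refine ContinuousLinearMap.ext fun v => ?_
  simp [inner_smul_left]
  ring

lemma gauss_lap {N : ℕ} (y : Euc N) (k : ℝ) (x : Euc N) :
    ∃ g' : Euc N →L[ℝ] Euc N,
      HasFDerivAt (fun z : Euc N => (-2 * k * Real.exp (-k * ‖z - y‖ ^ 2)) • (z - y)) g' x ∧
      ∑ i, g' (EuclideanSpace.single i 1) i =
        Real.exp (-k * ‖x - y‖ ^ 2) * (4 * k ^ 2 * ‖x - y‖ ^ 2 - 2 * k * N) := by
  have h1 : HasFDerivAt (fun z : Euc N => z - y) (ContinuousLinearMap.id ℝ (Euc N)) x :=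
    (hasFDerivAt_id x).sub_const y
  have h2 := ((h1.norm_sq.const_mul (-k)).exp).const_mul (-2 * k)
  refine ⟨_, h2.smul h1, ?_⟩
  obtain ⟨z, hz⟩ : ∃ z, z = x - y := ⟨_, rfl⟩
  rw [← hz]
  obtain ⟨E, hE⟩ : ∃ E, E = Real.exp (-k * ‖z‖ ^ 2) := ⟨_, rfl⟩
  rw [← hE]
  have s3 : ∑ i, (z i) * (z i) = ‖z‖ ^ 2 := by
    rw [EuclideanSpace.real_norm_sq_eq]
    exact Finset.sum_congr rfl fun i _ => by ring
  trans ∑ i : Fin N, ((4 * k ^ 2 * E) * (z i * z i) + (-2 * k * E))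
  · refine Finset.sum_congr rfl fun i _ => ?_
    simp [EuclideanSpace.inner_single_right]
    ring
  · rw [Finset.sum_add_distrib, ← Finset.mul_sum, s3]
    simp
    ring

lemma propagate {N : ℕ} {Ω : Set (Euc N)} (hΩ : IsOpen Ω)
    {c p : ℝ} (hc : 0 ≤ c) (hp : 1 < p) {u : Euc N → ℝ}
    (hu0 : ∀ᵐ x ∂volume, x ∈ Ω → 0 ≤ u x)
    (huloc : LocallyIntegrableOn u (Ω) volume)
    (hup : LocallyIntegrableOn (fun x => u x ^ p) (Ω) volume)
    (hbu : LocallyIntegrableOn (fun x => c * ‖x‖ ^ (-2 : ℝ) * u x) (Ω) volume)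
    (hsuper : ∀ φ : Euc N → ℝ, IsTestFun (Ω) φ → (∀ x, 0 ≤ φ x) →
      ∫ x in Ω, u x ^ p * φ x ≤
        ∫ x in Ω, u x * (-(lap φ x) - c * ‖x‖ ^ (-2 : ℝ) * φ x))
    {y : Euc N} {r ρ ρ' : ℝ} (hr : 0 < r) (hρ' : 0 < ρ') (hρ : ρ' < ρ)
    (hB : closedBall y ρ ⊆ Ω) (hz : ∀ᵐ x ∂volume, x ∈ ball y r → u x = 0) :
    ∀ᵐ x ∂volume, x ∈ ball y ρ' → u x = 0 := by
  obtain ⟨k, hk0, hk⟩ : ∃ k : ℝ, 0 < k ∧ N ≤ 2 * k * r ^ 2 := by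
    refine ⟨(N + 1) / (2 * r ^ 2), by positivity, ?_⟩
    have : 2 * (((N:ℝ) + 1) / (2 * r ^ 2)) * r ^ 2 = N + 1 := by field_simp
    linarith
  have hWlt : ∀ s : ℝ, ρ' < s → Real.exp (-k * s ^ 2) < Real.exp (-k * ρ' ^ 2) := by
    intro s hs
    apply Real.exp_lt_exp.2
    have : ρ' ^ 2 < s ^ 2 := by gcongr
    have := mul_lt_mul_of_pos_left this hk0
    linarith
  have hWgt : ∀ s : ℝ, 0 ≤ s → s < ρ' → Real.exp (-k * ρ' ^ 2) < Real.exp (-k * s ^ 2) := by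
    intro s hs0 hs
    apply Real.exp_lt_exp.2
    have : s ^ 2 < ρ' ^ 2 := by gcongr
    have := mul_lt_mul_of_pos_left this hk0
    linarith
  obtain ⟨δ0, hδ0, hcut⟩ := cutoff hΩ (isCompact_closedBall y ρ)
    (fun z : Euc N => Real.exp (-k * ‖z - y‖ ^ 2) - Real.exp (-k * ρ' ^ 2))
    (fun z : Euc N => (-2 * k * Real.exp (-k * ‖z - y‖ ^ 2)) • (z - y))
    (fun x : Euc N => Real.exp (-k * ‖x - y‖ ^ 2) * (4 * k ^ 2 * ‖x - y‖ ^ 2 - 2 * k * N))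
    (fun x _ => by
      have h1 : ContDiff ℝ (⊤ : ℕ∞) (fun z : Euc N => z - y) := contDiff_id.sub contDiff_const
      exact (((contDiff_const.mul (h1.norm_sq ℝ)).exp).sub contDiff_const).contDiffAt)
    (fun x _ => gauss_grad y k _ x)
    (fun x _ => gauss_lap y k x)
    (by
      intro x hx h
      rcases h with h | h
      · have h1 : x ∉ ball y ρ := fun h' => h (ball_subset_interior_closedBall h')
        rw [mem_ball, dist_eq_norm] at h1
        have := hWlt ‖x - y‖ (by linarith)
        change Real.exp (-k * ‖x - y‖ ^ 2) - Real.exp (-k * ρ' ^ 2) < 0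
        linarith
      · exact absurd (hB hx) h)
  obtain ⟨φ, hφt, hφ0, hφW, hφd⟩ := hcut δ0 hδ0 le_rfl
  obtain ⟨hi1, hi2⟩ := test_integrable huloc hup hbu hφt
  have hΩm : MeasurableSet Ω := hΩ.measurableSet
  have hsup := hsuper φ hφt hφ0
  have hu0r : ∀ᵐ x ∂volume.restrict Ω, 0 ≤ u x := (ae_restrict_iff' hΩm).2 hu0
  have hneg : ∫ x in Ω, u x * (-(lap φ x) - c * ‖x‖ ^ (-2 : ℝ) * φ x) ≤ 0 := by
    apply integral_nonpos_of_ae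
    filter_upwards [hu0r, ae_restrict_of_ae hz] with x hux hzx
    change u x * (-(lap φ x) - c * ‖x‖ ^ (-2 : ℝ) * φ x) ≤ 0
    by_cases hxb : x ∈ ball y r
    · rw [hzx hxb, zero_mul]
    · have h1 : 0 ≤ c * ‖x‖ ^ (-2 : ℝ) * φ x :=
        mul_nonneg (mul_nonneg hc (by positivity)) (hφ0 x)
      have h2 : 0 ≤ lap φ x := by
        rcases hφd x with h | ⟨-, -, -, d, hd, -, hdL⟩
        · exact h.1.ge
        · refine le_trans (mul_nonneg hd (mul_nonneg (Real.exp_pos _).le ?_)) hdL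
          rw [mem_ball, dist_eq_norm, not_lt] at hxb
          have h3 : r ^ 2 ≤ ‖x - y‖ ^ 2 := by gcongr
          have h4 := mul_le_mul_of_nonneg_left h3 (by positivity : 0 ≤ 4 * k ^ 2)
          have h5 := mul_le_mul_of_nonneg_left hk (by positivity : 0 ≤ 2 * k)
          linarith
      exact mul_nonpos_of_nonneg_of_nonpos hux (by linarith)
  have hnn : 0 ≤ᵐ[volume.restrict Ω] fun x => u x ^ p * φ x := by
    filter_upwards [hu0r] with x hx using mul_nonneg (Real.rpow_nonneg hx p) (hφ0 x)
  have hzero := (setIntegral_eq_zero_iff_of_nonneg_ae hnn hi1.integrableOn).1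
    (le_antisymm (hsup.trans hneg) (integral_nonneg_of_ae hnn))
  rw [Filter.EventuallyEq, ae_restrict_iff' hΩm] at hzero
  filter_upwards [hzero, hu0] with x hx hx0 hxb
  have hxc : x ∈ closedBall y ρ := ball_subset_closedBall (ball_subset_ball hρ.le hxb)
  have h1 := hx (hB hxc)
  have h2 := hx0 (hB hxc)
  have h3 := hφW x hxc
  rw [mem_ball, dist_eq_norm] at hxb
  have h4 := hWgt ‖x - y‖ (norm_nonneg _) hxb
  have h5 : φ x ≠ 0 := by
    have : 0 < φ x := by
      refine lt_of_lt_of_le ?_ h3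
      change 0 < Real.exp (-k * ‖x - y‖ ^ 2) - Real.exp (-k * ρ' ^ 2)
      linarith
    exact this.ne'
  have h6 : u x ^ p = 0 := (mul_eq_zero.1 h1).resolve_right h5
  exact (Real.rpow_eq_zero h2 (by linarith)).1 h6

/-- **Corollary 0.4.** Nonexistence of nontrivial nonnegative distributional supersolutions of
`-Δu - c|x|⁻²u ≥ uᵖ` on a smooth bounded domain `Ω ⊂ ℝ^N`, `N ≥ 7`, with `0 ∈ ∂Ω`, when
`N - 1 < c ≤ μ(Ω)` and `p ≥ p_{S₊^{N-1}}`. -/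
theorem nonexistence_smooth_bounded {N : ℕ} (hN : 7 ≤ N) (Ω : Set (Euc N))
    (hΩ : IsSmoothDomain Ω) (hΩbdd : Bornology.IsBounded Ω)
    (h0 : (0 : Euc N) ∈ frontier Ω)
    (c p : ℝ) (hc1 : (N : ℝ) - 1 < c) (hc2 : c ≤ hardyConst Ω)
    (hp : 1 + 2 / (((N : ℝ) - 2) / 2 - Real.sqrt ((N : ℝ) ^ 2 / 4 - c)) ≤ p)
    (u : Euc N → ℝ)
    (hu0 : ∀ᵐ x ∂volume, x ∈ Ω → 0 ≤ u x)
    (huloc : LocallyIntegrableOn u (Ω) volume)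
    (hup : LocallyIntegrableOn (fun x => u x ^ p) (Ω) volume)
    (hbu : LocallyIntegrableOn (fun x => c * ‖x‖ ^ (-2 : ℝ) * u x) (Ω) volume)
    (hsuper : ∀ φ : Euc N → ℝ, IsTestFun (Ω) φ → (∀ x, 0 ≤ φ x) →
      ∫ x in Ω, u x ^ p * φ x ≤
        ∫ x in Ω, u x * (-(lap φ x) - c * ‖x‖ ^ (-2 : ℝ) * φ x)) :
    ∀ᵐ x ∂volume, x ∈ Ω → u x = 0 := by
  obtain ⟨hp1, y0, hy0, r0, hr0, hz0⟩ := vanish_ball (by omega) Ω hΩ h0 c p hc1 hp u hu0 huloc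
    hup hbu hsuper
  have hc : 0 ≤ c := by
    have : (7:ℝ) ≤ N := by exact_mod_cast hN
    linarith
  obtain ⟨S, hS⟩ : ∃ S : Set (Euc N), S = {y | ∃ r > 0, ∀ᵐ x ∂volume, x ∈ ball y r → u x = 0} :=
    ⟨_, rfl⟩
  have hSmem : ∀ y, y ∈ S ↔ ∃ r > 0, ∀ᵐ x ∂volume, x ∈ ball y r → u x = 0 := by
    intro y; rw [hS]; rfl
  have hmono : ∀ (y : Euc N) (r : ℝ), (∀ᵐ x ∂volume, x ∈ ball y r → u x = 0) → ball y r ⊆ S := by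
    intro y r h z hzz
    obtain ⟨ε, hε, hsub⟩ := Metric.isOpen_iff.1 isOpen_ball z hzz
    rw [hSmem]
    refine ⟨ε, hε, ?_⟩
    filter_upwards [h] with x hx hxb using hx (hsub hxb)
  have hSo : IsOpen S := by
    rw [Metric.isOpen_iff]
    intro y hy
    obtain ⟨r, hr, h⟩ := (hSmem y).1 hy
    exact ⟨r, hr, hmono y r h⟩
  have hsub : Ω ⊆ S := by
    refine hΩ.2.2.1.isPreconnected.subset_of_closure_inter_subset hSo
      ⟨y0, hy0, (hSmem y0).2 ⟨r0, hr0, hz0⟩⟩ ?_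
    rintro z ⟨hzc, hzΩ⟩
    obtain ⟨R, hR, hRΩ⟩ := Metric.isOpen_iff.1 hΩ.1 z hzΩ
    obtain ⟨y, hyS, hyz⟩ := Metric.mem_closure_iff.1 hzc (R / 4) (by positivity)
    obtain ⟨r, hr, h⟩ := (hSmem y).1 hyS
    have h2 := propagate hΩ.1 hc hp1 hu0 huloc hup hbu hsuper hr
      (ρ := R / 2) (ρ' := R / 3) (by positivity) (by linarith) (fun x hx => by
        apply hRΩ
        rw [mem_closedBall] at hx
        rw [mem_ball]
        have := dist_triangle x y z
        rw [dist_comm y z] at this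
        linarith) h
    exact hmono y _ h2 (by rw [mem_ball]; linarith)
  have hnull : volume {x | x ∈ Ω ∧ u x ≠ 0} = 0 := by
    apply measure_null_of_locally_null
    rintro y ⟨hy, -⟩
    obtain ⟨r, hr, h⟩ := (hSmem y).1 (hsub hy)
    refine ⟨{x | x ∈ Ω ∧ u x ≠ 0} ∩ ball y r,
      inter_mem_nhdsWithin _ (ball_mem_nhds y hr), ?_⟩
    refine measure_mono_null ?_ (ae_iff.1 h)
    rintro x ⟨⟨-, hx⟩, hxb⟩ h'
    exact hx (h' hxb)
  rw [ae_iff]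
  refine measure_mono_null ?_ hnull
  intro x hx
  have hx : ¬ (x ∈ Ω → u x = 0) := hx
  push Not at hx
  exact hx
end
end

section
/- Let N ≥ 3, let B = B₁(E₁) ⊂ ℝ^N be the open unit ball centered at the first coordinate unit vector E₁ (so 0 ∈ ∂B), and let U = ℝ^N \ B̄ be its exterior. Let N − 1 < c ≤ N²/4 and 1 < p < p_{S_+^{N−1}} := 1 + 2/((N−2)/2 − √(N²/4 − c)). Then there exist r > 0 and a function w ∈ L^p(U ∩ B_r(0)) with w > 0 in U ∩ B_r(0) such that −Δw − c|x|^{−2}w ≥ w^p in the sense of distributions on U ∩ B_r(0), i.e. ∫ w(−Δφ − c|x|^{−2}φ) dx ≥ ∫ w^p φ dx for every nonnegative φ ∈ C_c^∞(U ∩ B_r(0)). -/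
open MeasureTheory Metric Filter
open scoped Topology ENNReal NNReal RealInnerProductSpace

noncomputable section

/-- The first coordinate unit vector `E₁ ∈ ℝ^N`. -/
def e1 (N : ℕ) : Euc N :=
  (WithLp.equiv 2 (Fin N → ℝ)).symm (fun i => if (i : ℕ) = 0 then 1 else 0)

/-- The region `U ∩ B_r(0)`, where `U = ℝ^N \\ B̄` is the exterior of the closed unit ball
centered at the first coordinate unit vector `E₁`. -/
def extRegion (N : ℕ) (r : ℝ) : Set (Euc N) :=
  (closure (ball (e1 N) 1))ᶜ ∩ ball (0 : Euc N) r

namespace Sub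

def S {N : ℕ} (x : Euc N) : ℝ := ‖x‖ ^ 2
def H {N : ℕ} (x : Euc N) : ℝ := ‖x‖ ^ 2 / 2 - (inner ℝ x (e1 N))

def v {N : ℕ} (k q : ℝ) (x : Euc N) : ℝ := (H x - k * H x ^ 2) * S x ^ q

def vi {N : ℕ} (k q : ℝ) (i : Fin N) (x : Euc N) : ℝ :=
  ((1 - 2 * k * H x) * (x i - e1 N i)) * S x ^ q
    + (H x - k * H x ^ 2) * (2 * q * x i * S x ^ (q - 1))

def vii {N : ℕ} (k q : ℝ) (i : Fin N) (x : Euc N) : ℝ :=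
  ((1 - 2 * k * H x) - 2 * k * (x i - e1 N i) ^ 2) * S x ^ q
    + 2 * ((1 - 2 * k * H x) * (x i - e1 N i)) * (2 * q * x i * S x ^ (q - 1))
    + (H x - k * H x ^ 2) * (2 * q * S x ^ (q - 1) + 4 * q * (q - 1) * x i ^ 2 * S x ^ (q - 2))

abbrev E {N : ℕ} (i : Fin N) : Euc N := EuclideanSpace.single i 1

lemma S_pos {N : ℕ} {x : Euc N} (hx : x ≠ 0) : 0 < S x := by
  unfold S; have := norm_pos_iff.2 hx; positivity

lemma hS {N : ℕ} (i : Fin N) (x : Euc N) : HasLineDerivAt ℝ S (2 * x i) x (E i) := by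
  have h := ((hasStrictFDerivAt_norm_sq x).hasFDerivAt).hasLineDerivAt (E i)
  have e : (2 • (innerSL ℝ) x) (E i) = 2 * x i := by
    simp [E, EuclideanSpace.inner_single_right]
  rw [← e]; exact h

lemma hT {N : ℕ} (i : Fin N) (x : Euc N) :
    HasLineDerivAt ℝ (fun x : Euc N => (inner ℝ x (e1 N))) (e1 N i) x (E i) := by
  have h : HasFDerivAt (fun x : Euc N => (inner ℝ (e1 N) x)) (innerSL ℝ (e1 N)) x :=
    (innerSL ℝ (e1 N)).hasFDerivAt
  have h := h.hasLineDerivAt (E i)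
  have e : (innerSL ℝ (e1 N)) (E i) = e1 N i := by
    simp [E, EuclideanSpace.inner_single_right]
  rw [e] at h
  simp_rw [real_inner_comm] at h
  exact h

lemma hX {N : ℕ} (i : Fin N) (x : Euc N) :
    HasLineDerivAt ℝ (fun x : Euc N => x i) 1 x (E i) := by
  have h : HasFDerivAt (fun x : Euc N => x i) (EuclideanSpace.proj i : Euc N →L[ℝ] ℝ) x :=
    (EuclideanSpace.proj i : Euc N →L[ℝ] ℝ).hasFDerivAt
  have h := h.hasLineDerivAt (E i)
  have e : (EuclideanSpace.proj i : Euc N →L[ℝ] ℝ) (E i) = 1 := by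
    simp [E]
  rw [← e]; exact h

lemma hH {N : ℕ} (i : Fin N) (x : Euc N) :
    HasLineDerivAt ℝ H (x i - e1 N i) x (E i) := by
  have h := HasDerivAt.sub (HasDerivAt.div_const (hS i x) 2) (hT i x)
  exact HasDerivAt.congr_deriv h (by ring)

lemma hSq {N : ℕ} (q : ℝ) (i : Fin N) {x : Euc N} (hx : x ≠ 0) :
    HasLineDerivAt ℝ (fun x => S x ^ q) (2 * q * x i * S x ^ (q - 1)) x (E i) := by
  have h := HasDerivAt.rpow_const (p := q) (hS i x) (Or.inl (by simpa using (S_pos hx).ne'))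
  exact HasDerivAt.congr_deriv h (by simp only [zero_smul, add_zero]; ring)

lemma hv {N : ℕ} (k q : ℝ) (i : Fin N) {x : Euc N} (hx : x ≠ 0) :
    HasLineDerivAt ℝ (v k q) (vi k q i x) x (E i) := by
  have h := HasDerivAt.mul (HasDerivAt.sub (hH i x) (((hH i x).pow 2).const_mul k)) (hSq q i hx)
  exact HasDerivAt.congr_deriv h (by simp [vi]; try ring_nf; try simp)

lemma hvi {N : ℕ} (k q : ℝ) (i : Fin N) {x : Euc N} (hx : x ≠ 0) :
    HasLineDerivAt ℝ (vi k q i) (vii k q i x) x (E i) := by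
  have hHd : HasDerivAt (fun t : ℝ => H (x + t • E i)) (x i - e1 N i) 0 := hH i x
  have hXd : HasDerivAt (fun t : ℝ => (x + t • E i) i) 1 0 := hX i x
  have h1 := hSq q i hx
  have h2 := hSq (q - 1) i hx
  unfold HasLineDerivAt at h1 h2
  have h := HasDerivAt.add
    (HasDerivAt.mul (HasDerivAt.mul ((hHd.const_mul (2 * k)).const_sub 1) (hXd.sub_const (e1 N i))) h1)
    (HasDerivAt.mul (HasDerivAt.sub hHd ((hHd.pow 2).const_mul k))
      (HasDerivAt.mul (hXd.const_mul (2 * q)) h2))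
  have e : q - 1 - 1 = q - 2 := by ring
  exact HasDerivAt.congr_deriv h (by simp [vii, e]; ring)

lemma contS {N : ℕ} : Continuous (S : Euc N → ℝ) := by unfold S; fun_prop
lemma contH {N : ℕ} : Continuous (H : Euc N → ℝ) := by unfold H; fun_prop
lemma contSq {N : ℕ} (q : ℝ) : ContinuousOn (fun x : Euc N => S x ^ q) {0}ᶜ :=
  contS.continuousOn.rpow_const (fun x hx => Or.inl (S_pos hx).ne')
lemma contv {N : ℕ} (k q : ℝ) : ContinuousOn (v k q : Euc N → ℝ) {0}ᶜ := by
  unfold v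
  have := contH (N := N)
  have := contSq (N := N) q
  fun_prop
lemma contvi {N : ℕ} (k q : ℝ) (i : Fin N) : ContinuousOn (vi k q i : Euc N → ℝ) {0}ᶜ := by
  unfold vi
  have := contH (N := N)
  have := contSq (N := N) q
  have := contSq (N := N) (q - 1)
  fun_prop
lemma contvii {N : ℕ} (k q : ℝ) (i : Fin N) : ContinuousOn (vii k q i : Euc N → ℝ) {0}ᶜ := by
  unfold vii
  have := contH (N := N)
  have := contSq (N := N) q
  have := contSq (N := N) (q - 1)
  have := contSq (N := N) (q - 2)
  fun_prop

lemma sum_xx {N : ℕ} (x : Euc N) : ∑ i, x i ^ 2 = S x := by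
  simp [S, EuclideanSpace.norm_sq_eq]
lemma sum_xe {N : ℕ} (x : Euc N) : ∑ i, x i * e1 N i = S x / 2 - H x := by
  have : (inner ℝ x (e1 N)) = ∑ i, x i * e1 N i := by
    simp [PiLp.inner_apply, mul_comm]
  unfold S H; rw [this]; ring
lemma sum_ee {N : ℕ} (hN : 3 ≤ N) : ∑ i, e1 N i ^ 2 = 1 := by
  obtain ⟨n, rfl⟩ : ∃ n, N = n + 1 := ⟨N - 1, by omega⟩
  simp [e1, ite_pow, Fin.sum_univ_succ]

lemma sum_vii {N : ℕ} (hN : 3 ≤ N) (k q : ℝ) {x : Euc N} (hx : x ≠ 0) :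
    ∑ i, vii k q i x = S x ^ (q - 1) *
      (((1 - 2 * k * H x) * N - 2 * k * (1 + 2 * H x)) * S x
        + 4 * q * (1 - 2 * k * H x) * (H x + S x / 2)
        + (H x - k * H x ^ 2) * (2 * q * N + 4 * q * (q - 1))) := by
  have hs := S_pos hx
  have e1' : S x ^ q = S x ^ (q - 1) * S x := by
    conv_rhs => rw [← Real.rpow_add_one hs.ne']
    ring_nf
  have e2 : S x ^ (q - 2) = S x ^ (q - 1) / S x := by
    rw [← Real.rpow_sub_one hs.ne']; ring_nf
  have key : ∀ i, vii k q i x = S x ^ (q - 1) *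
      ((1 - 2 * k * H x) * S x + (H x - k * H x ^ 2) * (2 * q))
      + S x ^ (q - 1) * (-2 * k * S x + 4 * q * (1 - 2 * k * H x)
          + (H x - k * H x ^ 2) * 4 * q * (q - 1) / S x) * x i ^ 2
      + S x ^ (q - 1) * (4 * k * S x - 4 * q * (1 - 2 * k * H x)) * (x i * e1 N i)
      + S x ^ (q - 1) * (-2 * k * S x) * (e1 N i) ^ 2 := by
    intro i; unfold vii; rw [e1', e2]; ring
  simp_rw [key]
  rw [Finset.sum_add_distrib, Finset.sum_add_distrib, Finset.sum_add_distrib, Finset.sum_const,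
    ← Finset.mul_sum, ← Finset.mul_sum, ← Finset.mul_sum, sum_xx, sum_xe, sum_ee hN]
  simp only [Finset.card_univ, Fintype.card_fin, nsmul_eq_mul]
  field_simp
  ring


lemma int_mul {N : ℕ} {f g : Euc N → ℝ} (hf : ContinuousOn f {0}ᶜ) (hg : Continuous g)
    (hc : HasCompactSupport g) (h0 : tsupport g ⊆ {0}ᶜ) :
    Integrable (fun x => f x * g x) volume := by
  apply Continuous.integrable_of_hasCompactSupport
  · apply continuous_of_tsupport
    intro x hx
    have hx' : x ∈ ({0}ᶜ : Set (Euc N)) := h0 (tsupport_mul_subset_right hx)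
    exact (hf.continuousAt (isOpen_compl_singleton.mem_nhds hx')).mul hg.continuousAt
  · exact hc.mul_left

lemma ibp1 {N : ℕ} {f f' g g' : Euc N → ℝ} {i : Fin N}
    (hf : ContinuousOn f {0}ᶜ) (hf' : ContinuousOn f' {0}ᶜ) (hg : Continuous g)
    (hg' : Continuous g')
    (hc : HasCompactSupport g) (h0 : tsupport g ⊆ {0}ᶜ)
    (hc' : HasCompactSupport g') (h0' : tsupport g' ⊆ {0}ᶜ)
    (hd : ∀ x ≠ 0, HasLineDerivAt ℝ f (f' x) x (E i))
    (hd' : ∀ x, HasLineDerivAt ℝ g (g' x) x (E i)) :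
    ∫ x, f x * g' x = - ∫ x, f' x * g x :=
  integral_bilinear_hasLineDerivAt_right_eq_neg_left_of_integrable
    (B := ContinuousLinearMap.mul ℝ ℝ) (μ := volume) (int_mul hf' hg hc h0)
    (int_mul hf hg' hc' h0') (int_mul hf hg hc h0) (fun x hx => hd x (h0 hx)) (fun x _ => hd' x)

def di {N : ℕ} (i : Fin N) (φ : Euc N → ℝ) (x : Euc N) : ℝ := fderiv ℝ φ x (E i)

lemma di_smooth {N : ℕ} (i : Fin N) {φ : Euc N → ℝ} (h : ContDiff ℝ (⊤ : ℕ∞) φ) :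
    ContDiff ℝ (⊤ : ℕ∞) (di i φ) := by
  unfold di
  exact (h.fderiv_right (m := (⊤ : ℕ∞)) (by simp)).clm_apply contDiff_const

lemma di_tsupport {N : ℕ} (i : Fin N) (φ : Euc N → ℝ) : tsupport (di i φ) ⊆ tsupport φ :=
  tsupport_fderiv_apply_subset ℝ (E i)

lemma di_line {N : ℕ} (i : Fin N) {φ : Euc N → ℝ} (h : ContDiff ℝ (⊤ : ℕ∞) φ) (x : Euc N) :
    HasLineDerivAt ℝ φ (di i φ x) x (E i) :=
  ((h.differentiable (by simp)) x).hasFDerivAt.hasLineDerivAt (E i)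

lemma lap_eq {N : ℕ} {φ : Euc N → ℝ} (h : ContDiff ℝ (⊤ : ℕ∞) φ) (x : Euc N) :
    lap φ x = ∑ i, di i (di i φ) x := by
  unfold lap
  refine Finset.sum_congr rfl fun i _ => ?_
  rw [iteratedFDeriv_two_apply]
  have hd : DifferentiableAt ℝ (fderiv ℝ φ) x :=
    ((h.fderiv_right (m := (⊤ : ℕ∞)) (by simp)).differentiable (by simp)) x
  unfold di
  rw [fderiv_clm_apply hd (differentiableAt_const _)]
  simp

lemma green {N : ℕ} {w : Euc N → ℝ} {wi wii : Fin N → Euc N → ℝ} {φ : Euc N → ℝ}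
    (h : ContDiff ℝ (⊤ : ℕ∞) φ) (hc : HasCompactSupport φ) (h0 : tsupport φ ⊆ {0}ᶜ)
    (cw : ContinuousOn w {0}ᶜ) (cwi : ∀ i, ContinuousOn (wi i) {0}ᶜ)
    (cwii : ∀ i, ContinuousOn (wii i) {0}ᶜ)
    (dw : ∀ i, ∀ x ≠ 0, HasLineDerivAt ℝ w (wi i x) x (E i))
    (dwi : ∀ i, ∀ x ≠ 0, HasLineDerivAt ℝ (wi i) (wii i x) x (E i)) :
    Integrable (fun x => w x * lap φ x) ∧ Integrable (fun x => (∑ i, wii i x) * φ x) ∧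
    ∫ x, w x * lap φ x = ∫ x, (∑ i, wii i x) * φ x := by
  have s1 : ∀ i, tsupport (di i φ) ⊆ {0}ᶜ := fun i => (di_tsupport i φ).trans h0
  have s2 : ∀ i, tsupport (di i (di i φ)) ⊆ {0}ᶜ := fun i => (di_tsupport i _).trans (s1 i)
  have c1 : ∀ i, HasCompactSupport (di i φ) := fun i =>
    hc.of_isClosed_subset (isClosed_tsupport _) (di_tsupport i φ)
  have c2 : ∀ i, HasCompactSupport (di i (di i φ)) := fun i =>
    (c1 i).of_isClosed_subset (isClosed_tsupport _) (di_tsupport i _)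
  have d1 := fun i => di_smooth i h
  have d2 := fun i => di_smooth i (d1 i)
  have i1 : ∀ i, Integrable (fun x => w x * di i (di i φ) x) := fun i =>
    int_mul cw (d2 i).continuous (c2 i) (s2 i)
  have i2 : ∀ i, Integrable (fun x => wii i x * φ x) := fun i =>
    int_mul (cwii i) h.continuous hc h0
  simp_rw [lap_eq h, Finset.mul_sum, Finset.sum_mul]
  refine ⟨integrable_finsetSum _ fun i _ => i1 i, integrable_finsetSum _ fun i _ => i2 i, ?_⟩
  rw [integral_finsetSum _ fun i _ => i1 i, integral_finsetSum _ fun i _ => i2 i]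
  refine Finset.sum_congr rfl fun i _ => ?_
  rw [ibp1 cw (cwi i) (d1 i).continuous (d2 i).continuous (c1 i) (s1 i) (c2 i) (s2 i) (dw i)
      (di_line i (d1 i)),
    ibp1 (cwi i) (cwii i) h.continuous (d1 i).continuous hc h0 (c1 i) (s1 i) (dwi i)
      (di_line i h), neg_neg]

lemma int_pow {N : ℕ} (hN : 3 ≤ N) {s r : ℝ} (hs : s < N) :
    IntegrableOn (fun x : Euc N => ‖x‖ ^ (-s)) (ball 0 r) volume := by
  have : Nontrivial (Euc N) := by
    have : Nonempty (Fin N) := ⟨⟨0, by omega⟩⟩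
    infer_instance
  rw [MeasureTheory.integrableOn_fun_norm_addHaar volume (f := fun y => y ^ (-s))]
  have h : IntegrableOn (fun y : ℝ => y ^ ((N : ℝ) - 1 - s)) (Set.Ioo 0 r) := by
    rcases le_or_gt r 0 with h | h
    · simp [Set.Ioo_eq_empty_of_le h]
    · exact (intervalIntegral.integrableOn_Ioo_rpow_iff h).2 (by linarith)
  refine h.congr_fun (fun y hy => ?_) measurableSet_Ioo
  have hy0 : 0 < y := hy.1
  simp only [finrank_euclideanSpace, Fintype.card_fin, smul_eq_mul]
  rw [← Real.rpow_natCast, ← Real.rpow_add hy0, Nat.cast_sub (by omega)]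
  congr 1; push_cast; ring

lemma poly_ineq {n b δ K c S H R ρ : ℝ} (hK : K = n / 2) (hc : c = b * (n - b))
    (hb : 1 < b) (h2b : 2 * b ≤ n) (hδ : 0 < δ) (hS : 0 < S) (hH : 0 < H) (hR : 0 < R)
    (hHρ : H ≤ 2 * ρ) (h3 : 4 * b * K * ρ ≤ δ ^ 2 / 2 * R) :
    δ ^ 2 / 2 * H * R ≤
      -(((1 - 2 * K * H) * n - 2 * K * (1 + 2 * H)) * S
        + 4 * (-b / 2) * (1 - 2 * K * H) * (H + S / 2)
        + (H - K * H ^ 2) * (2 * (-b / 2) * n + 4 * (-b / 2) * (-b / 2 - 1)))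
      + R * (((1 - 2 * 0 * H) * n - 2 * 0 * (1 + 2 * H)) * S
        + 4 * ((δ - b) / 2) * (1 - 2 * 0 * H) * (H + S / 2)
        + (H - 0 * H ^ 2) * (2 * ((δ - b) / 2) * n + 4 * ((δ - b) / 2) * ((δ - b) / 2 - 1)))
      - c * ((H - K * H ^ 2) - (H - 0 * H ^ 2) * R) := by
  have hKp : 0 < K := by rw [hK]; linarith
  have t1 : 0 ≤ (2 * K - (n - b)) * S := mul_nonneg (by rw [hK]; linarith) hS.le
  have t2 : 0 ≤ K * (4 + 2 * n - 2 * b) * H * S := by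
    have : 0 < 4 + 2 * n - 2 * b := by linarith
    positivity
  have t3 : 0 ≤ R * ((n - b + δ) * S) := by
    have : 0 < n - b + δ := by linarith
    positivity
  have t4 : 0 ≤ R * (δ * (n - 2 * b) * H) := by
    have : 0 ≤ n - 2 * b := by linarith
    positivity
  have t5 : 2 * b * K * H ^ 2 ≤ δ ^ 2 / 2 * R * H := by
    have : 2 * b * K * H ≤ 4 * b * K * ρ := by
      have := mul_le_mul_of_nonneg_left hHρ (show 0 ≤ 2 * b * K by positivity)
      linarith
    have := mul_le_mul_of_nonneg_right (this.trans h3) hH.le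
    linarith
  have key : -(((1 - 2 * K * H) * n - 2 * K * (1 + 2 * H)) * S
        + 4 * (-b / 2) * (1 - 2 * K * H) * (H + S / 2)
        + (H - K * H ^ 2) * (2 * (-b / 2) * n + 4 * (-b / 2) * (-b / 2 - 1)))
      + R * (((1 - 2 * 0 * H) * n - 2 * 0 * (1 + 2 * H)) * S
        + 4 * ((δ - b) / 2) * (1 - 2 * 0 * H) * (H + S / 2)
        + (H - 0 * H ^ 2) * (2 * ((δ - b) / 2) * n + 4 * ((δ - b) / 2) * ((δ - b) / 2 - 1)))
      - c * ((H - K * H ^ 2) - (H - 0 * H ^ 2) * R)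
      = (2 * K - (n - b)) * S + K * (4 + 2 * n - 2 * b) * H * S - 2 * b * K * H ^ 2
        + R * ((n - b + δ) * S) + R * (δ * (n - 2 * b) * H) + δ ^ 2 * R * H := by
    rw [hc]; ring
  rw [key]
  nlinarith

lemma choose_r {b δ K p γ : ℝ} (hδ : 0 < δ) (hδ1 : δ < 1) (hγ : 0 < γ) :
    ∃ r > (0 : ℝ), ∀ ρ ∈ Set.Ioo 0 r, ρ < 1 ∧ 2 * K * ρ + ρ ^ δ < 1 ∧
      4 * b * K * ρ ≤ δ ^ 2 / 2 * ρ ^ δ ∧ 2 ^ (p - 1) * ρ ^ γ ≤ δ ^ 2 / 2 := by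
  have tp : ∀ a : ℝ, 0 < a → Tendsto (fun ρ : ℝ => ρ ^ a) (𝓝[>] 0) (𝓝 0) := by
    intro a ha
    have := (Real.continuousAt_rpow_const 0 a (Or.inr ha.le)).tendsto
    rw [Real.zero_rpow ha.ne'] at this
    exact this.mono_left nhdsWithin_le_nhds
  have tid : Tendsto (fun ρ : ℝ => ρ) (𝓝[>] 0) (𝓝 0) := tendsto_id.mono_left nhdsWithin_le_nhds
  have a1 : ∀ᶠ ρ : ℝ in 𝓝[>] 0, ρ < 1 := tid.eventually_lt_const one_pos
  have a2 : ∀ᶠ ρ : ℝ in 𝓝[>] 0, 2 * K * ρ + ρ ^ δ < 1 := by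
    have := (tid.const_mul (2 * K)).add (tp δ hδ)
    exact this.eventually_lt_const (by simp)
  have a3 : ∀ᶠ ρ : ℝ in 𝓝[>] 0, 4 * b * K * ρ ^ (1 - δ) < δ ^ 2 / 2 := by
    have := (tp (1 - δ) (by linarith)).const_mul (4 * b * K)
    exact this.eventually_lt_const (by rw [mul_zero]; positivity)
  have a4 : ∀ᶠ ρ : ℝ in 𝓝[>] 0, 2 ^ (p - 1) * ρ ^ γ < δ ^ 2 / 2 := by
    have := (tp γ hγ).const_mul (2 ^ (p - 1))
    exact this.eventually_lt_const (by rw [mul_zero]; positivity)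
  obtain ⟨r, hr, hsub⟩ := mem_nhdsGT_iff_exists_Ioo_subset.1 (a1.and (a2.and (a3.and a4)))
  refine ⟨r, hr, fun ρ hρ => ?_⟩
  obtain ⟨b1, b2, b3, b4⟩ := hsub hρ
  refine ⟨b1, b2, ?_, b4.le⟩
  have hρ0 : 0 < ρ := hρ.1
  have : ρ = ρ ^ (1 - δ) * ρ ^ δ := by
    rw [← Real.rpow_add hρ0]; simp
  have h := mul_le_mul_of_nonneg_right b3.le (Real.rpow_nonneg hρ0.le δ)
  calc 4 * b * K * ρ = 4 * b * K * (ρ ^ (1 - δ) * ρ ^ δ) := by rw [← this]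
    _ ≤ _ := by linarith

lemma region {N : ℕ} (hN : 3 ≤ N) {r : ℝ} {x : Euc N} (hx : x ∈ extRegion N r) :
    x ≠ 0 ∧ 0 < H x ∧ ‖x‖ < r ∧ H x ≤ ‖x‖ + ‖x‖ ^ 2 / 2 := by
  have he : ‖e1 N‖ = 1 := by
    have := EuclideanSpace.norm_sq_eq (e1 N)
    simp only [Real.norm_eq_abs, sq_abs] at this
    rw [sum_ee hN] at this
    nlinarith [norm_nonneg (e1 N)]
  obtain ⟨h1, h2⟩ := hx
  rw [closure_ball _ one_ne_zero] at h1
  simp only [Set.mem_compl_iff, mem_closedBall, dist_eq_norm, not_le] at h1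
  have h3 := norm_sub_sq_real x (e1 N)
  have h4 : 0 < H x := by unfold H; rw [he] at h3; nlinarith
  refine ⟨?_, h4, by simpa using h2, ?_⟩
  · rintro rfl; simp [H] at h4
  · have := neg_le_of_abs_le (abs_real_inner_le_norm x (e1 N))
    rw [he] at this
    unfold H; linarith

lemma isOpen_region (N : ℕ) (r : ℝ) : IsOpen (extRegion N r) :=
  isClosed_closure.isOpen_compl.inter isOpen_ball

end Sub

open Sub in
/-- **Proposition 3.2 (sharpness).** For `N - 1 < c ≤ N²/4` and `1 < p < p_{S₊^{N-1}}`,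
there is a positive supersolution `w ∈ Lᵖ` of `-Δw - c|x|⁻²w ≥ wᵖ` on `U ∩ B_r(0)` for some
small `r > 0`, where `U` is the exterior of the closed unit ball `B₁(E₁)`. -/
theorem existence_subcritical {N : ℕ} (hN : 3 ≤ N) (c p : ℝ)
    (hc1 : (N : ℝ) - 1 < c) (hc2 : c ≤ (N : ℝ) ^ 2 / 4)
    (hp1 : 1 < p)
    (hp2 : p < 1 + 2 / (((N : ℝ) - 2) / 2 - Real.sqrt ((N : ℝ) ^ 2 / 4 - c))) :
    ∃ r > (0:ℝ), ∃ w : Euc N → ℝ,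
      (∀ x ∈ extRegion N r, 0 < w x) ∧
      IntegrableOn (fun x => w x ^ p) (extRegion N r) volume ∧
      LocallyIntegrableOn w (extRegion N r) volume ∧
      LocallyIntegrableOn (fun x => ‖x‖ ^ (-2 : ℝ) * w x) (extRegion N r) volume ∧
      (∀ φ : Euc N → ℝ, IsTestFun (extRegion N r) φ → (∀ x, 0 ≤ φ x) →
        ∫ x in extRegion N r, w x ^ p * φ x ≤
          ∫ x in extRegion N r, w x * (-(lap φ x) - c * ‖x‖ ^ (-2 : ℝ) * φ x)) := by
  have hn3 : (3 : ℝ) ≤ N := by exact_mod_cast hN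
  obtain ⟨b, hbdef⟩ : ∃ b : ℝ, b = N / 2 - Real.sqrt ((N : ℝ) ^ 2 / 4 - c) := ⟨_, rfl⟩
  have hsq := Real.sq_sqrt (show 0 ≤ (N : ℝ) ^ 2 / 4 - c by linarith)
  have hsq0 := Real.sqrt_nonneg ((N : ℝ) ^ 2 / 4 - c)
  have hcb : c = b * (N - b) := by rw [hbdef]; nlinarith
  have h2b : 2 * b ≤ N := by rw [hbdef]; linarith
  have hb : 1 < b := by
    have : Real.sqrt ((N : ℝ) ^ 2 / 4 - c) < N / 2 - 1 := by
      rw [Real.sqrt_lt' (by linarith)]; nlinarith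
    rw [hbdef]; linarith
  have hα : ((N : ℝ) - 2) / 2 - Real.sqrt ((N : ℝ) ^ 2 / 4 - c) = b - 1 := by rw [hbdef]; ring
  rw [hα] at hp2
  have hpb : (b - 1) * (p - 1) < 2 := by
    have : p - 1 < 2 / (b - 1) := by linarith
    rw [lt_div_iff₀ (by linarith)] at this
    linarith
  obtain ⟨δ, hδ, hδ1, hδ2⟩ : ∃ δ : ℝ, 0 < δ ∧ δ < 1 ∧ δ < 2 - (b - 1) * (p - 1) := by
    obtain ⟨δ, h1, h2⟩ := exists_between (show 0 < min 1 (2 - (b - 1) * (p - 1)) from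
      lt_min one_pos (by linarith))
    exact ⟨δ, h1, h2.trans_le (min_le_left _ _), h2.trans_le (min_le_right _ _)⟩
  obtain ⟨K, hK⟩ : ∃ K : ℝ, K = N / 2 := ⟨_, rfl⟩
  have hKp : 0 < K := by rw [hK]; linarith
  obtain ⟨r, hr, hrρ⟩ := choose_r (b := b) (δ := δ) (K := K) (p := p)
    (γ := 2 - δ - (b - 1) * (p - 1)) hδ hδ1 (by linarith)
  let w : Euc N → ℝ := fun x => v K (-b / 2) x - v 0 ((δ - b) / 2) x
  have cw : ContinuousOn w {0}ᶜ := (contv _ _).sub (contv _ _)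
  have hsub : extRegion N r ⊆ {0}ᶜ := fun x hx => (region hN hx).1
  have hSrpow : ∀ x : Euc N, ∀ q : ℝ, S x ^ q = ‖x‖ ^ (2 * q) := by
    intro x q
    rw [Real.rpow_mul (norm_nonneg x)]
    simp [S]
  -- basic pointwise facts
  have pw : ∀ x ∈ extRegion N r, 0 < ‖x‖ ∧ H x ≤ 2 * ‖x‖ ∧ 0 < H x ∧ 0 < w x ∧
      w x ≤ H x * ‖x‖ ^ (-b) := by
    intro x hx
    obtain ⟨hx0, hH, hxr, hHle⟩ := region hN hx
    have hρ := norm_pos_iff.2 hx0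
    obtain ⟨c1, c2, c3, c4⟩ := hrρ ‖x‖ ⟨hρ, hxr⟩
    have hH2 : H x ≤ 2 * ‖x‖ := by nlinarith
    have e1 : S x ^ (-b / 2) = ‖x‖ ^ (-b) := by rw [hSrpow]; congr 1; ring
    have e2 : S x ^ ((δ - b) / 2) = ‖x‖ ^ (-b) * ‖x‖ ^ δ := by
      rw [hSrpow, ← Real.rpow_add hρ]; congr 1; ring
    have ew : w x = H x * ‖x‖ ^ (-b) * (1 - ‖x‖ ^ δ - K * H x) := by
      simp only [w, v, e1, e2]; ring
    have hP : 0 < ‖x‖ ^ (-b) := Real.rpow_pos_of_pos hρ _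
    have hR : 0 < ‖x‖ ^ δ := Real.rpow_pos_of_pos hρ _
    have hKH : K * H x ≤ 2 * K * ‖x‖ := by nlinarith
    refine ⟨hρ, hH2, hH, ?_, ?_⟩
    · rw [ew]
      have : 0 < 1 - ‖x‖ ^ δ - K * H x := by linarith
      positivity
    · rw [ew]
      have : 0 < K * H x := by positivity
      exact mul_le_of_le_one_right (by positivity) (by linarith)
  have cnorm : ContinuousOn (fun x : Euc N => ‖x‖ ^ (-2 : ℝ)) {0}ᶜ :=
    continuous_norm.continuousOn.rpow_const (fun x hx => Or.inl (norm_ne_zero_iff.2 hx))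
  have hms : MeasurableSet (extRegion N r) := (isOpen_region N r).measurableSet
  refine ⟨r, hr, w, fun x hx => (pw x hx).2.2.2.1, ?_, ?_, ?_, ?_⟩
  · have hs : (b - 1) * p < N := by nlinarith
    have hi := ((int_pow hN (r := r) hs).mono_set
      (Set.inter_subset_right : extRegion N r ⊆ _)).const_mul (2 ^ p)
    refine Integrable.mono' hi ?_ ?_
    · refine ContinuousOn.aestronglyMeasurable ?_ hms
      exact (cw.mono hsub).rpow_const (fun x hx => Or.inl (pw x hx).2.2.2.1.ne')
    · refine (ae_restrict_iff' hms).2 (Eventually.of_forall fun x hx => ?_)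
      obtain ⟨hρ, hH2, hH, hw, hwle⟩ := pw x hx
      rw [Real.norm_of_nonneg (Real.rpow_nonneg hw.le _)]
      have h1 : w x ≤ 2 * ‖x‖ ^ (1 - b) := by
        have h2 : ‖x‖ ^ (1 - b) = ‖x‖ * ‖x‖ ^ (-b) := by
          rw [sub_eq_add_neg, Real.rpow_add hρ, Real.rpow_one]
        rw [h2]
        have := mul_le_mul_of_nonneg_right hH2 (Real.rpow_nonneg hρ.le (-b))
        linarith
      calc w x ^ p ≤ (2 * ‖x‖ ^ (1 - b)) ^ p := Real.rpow_le_rpow hw.le h1 (by linarith)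
        _ = 2 ^ p * ‖x‖ ^ (-((b - 1) * p)) := by
          rw [Real.mul_rpow (by norm_num) (Real.rpow_nonneg hρ.le _), ← Real.rpow_mul hρ.le]
          congr 2; ring
  · exact (cw.mono hsub).locallyIntegrableOn hms
  · exact ((cnorm.mul cw).mono hsub).locallyIntegrableOn hms
  · intro φ ⟨hφ, hφc, hφs⟩ hφ0
    have h0 : tsupport φ ⊆ {0}ᶜ := hφs.trans hsub
    obtain ⟨I1, I2, I3⟩ := green (w := w)
      (wi := fun i x => vi K (-b / 2) i x - vi 0 ((δ - b) / 2) i x)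
      (wii := fun i x => vii K (-b / 2) i x - vii 0 ((δ - b) / 2) i x) hφ hφc h0 cw
      (fun i => (contvi _ _ i).sub (contvi _ _ i)) (fun i => (contvii _ _ i).sub (contvii _ _ i))
      (fun i x hx => HasDerivAt.sub (hv _ _ i hx) (hv _ _ i hx))
      (fun i x hx => HasDerivAt.sub (hvi _ _ i hx) (hvi _ _ i hx))
    have I4 : Integrable (fun x => (c * ‖x‖ ^ (-2 : ℝ) * w x) * φ x) :=
      int_mul ((cnorm.const_smul c).mul cw) hφ.continuous hφc h0
    have hφz : ∀ x, x ∉ extRegion N r → φ x = 0 := fun x hx =>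
      image_eq_zero_of_notMem_tsupport (fun h => hx (hφs h))
    have hlz : ∀ x, x ∉ extRegion N r → lap φ x = 0 := by
      intro x hx
      rw [lap_eq hφ]
      refine Finset.sum_eq_zero fun i _ => image_eq_zero_of_notMem_tsupport (fun h => hx (hφs ?_))
      exact di_tsupport i _ (di_tsupport i _ h)
    rw [setIntegral_eq_integral_of_forall_compl_eq_zero (fun x hx => by rw [hφz x hx, mul_zero]),
      setIntegral_eq_integral_of_forall_compl_eq_zero
        (fun x hx => by rw [hφz x hx, hlz x hx]; simp)]
    have e : ∫ x, w x * (-(lap φ x) - c * ‖x‖ ^ (-2 : ℝ) * φ x) =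
        ∫ x, (-((∑ i, (vii K (-b / 2) i x - vii 0 ((δ - b) / 2) i x)) * φ x)
          - (c * ‖x‖ ^ (-2 : ℝ) * w x) * φ x) := by
      rw [integral_sub I2.fun_neg I4, integral_neg, ← I3, ← integral_neg, ← integral_sub I1.fun_neg I4]
      congr 1; ext x; ring
    rw [e]
    refine integral_mono_of_nonneg ?_ (I2.neg.sub I4) ?_
    · refine Eventually.of_forall fun x => ?_
      by_cases hx : x ∈ extRegion N r
      · exact mul_nonneg (Real.rpow_nonneg (pw x hx).2.2.2.1.le _) (hφ0 x)
      · simp [hφz x hx]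
    · refine Eventually.of_forall fun x => ?_
      by_cases hx : x ∈ extRegion N r
      swap
      · simp [hφz x hx]
      obtain ⟨hρ, hH2, hH, hw, hwle⟩ := pw x hx
      obtain ⟨hx0, -, hxr, -⟩ := region hN hx
      obtain ⟨c1, c2, c3, c4⟩ := hrρ ‖x‖ ⟨hρ, hxr⟩
      have hR : 0 < ‖x‖ ^ δ := Real.rpow_pos_of_pos hρ _
      have hS0 := S_pos hx0
      have P := poly_ineq hK hcb hb h2b hδ hS0 hH hR hH2 c3
      have e1 : S x ^ (-b / 2 - 1) = ‖x‖ ^ (-b - 2) := by rw [hSrpow]; congr 1; ring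
      have e2 : S x ^ ((δ - b) / 2 - 1) = ‖x‖ ^ (-b - 2) * ‖x‖ ^ δ := by
        rw [hSrpow, ← Real.rpow_add hρ]; congr 1; ring
      have e3 : ‖x‖ ^ (-2 : ℝ) * w x = ‖x‖ ^ (-b - 2) *
          ((H x - K * H x ^ 2) - (H x - 0 * H x ^ 2) * ‖x‖ ^ δ) := by
        have f1 : ‖x‖ ^ (-b - 2) = ‖x‖ ^ (-2 : ℝ) * S x ^ (-b / 2) := by
          rw [hSrpow, ← Real.rpow_add hρ]; congr 1; ring
        have f2 : S x ^ ((δ - b) / 2) = S x ^ (-b / 2) * ‖x‖ ^ δ := by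
          rw [hSrpow, hSrpow, ← Real.rpow_add hρ]; congr 1; ring
        simp only [w, v, f1, f2]; ring
      have hlap : ‖x‖ ^ (-b - 2) * (δ ^ 2 / 2 * H x * ‖x‖ ^ δ) ≤
          -(∑ i, (vii K (-b / 2) i x - vii 0 ((δ - b) / 2) i x)) - c * (‖x‖ ^ (-2 : ℝ) * w x) := by
        rw [Finset.sum_sub_distrib, sum_vii hN _ _ hx0, sum_vii hN _ _ hx0, e1, e2, e3]
        have := mul_le_mul_of_nonneg_left P (Real.rpow_nonneg hρ.le (-b - 2))
        refine this.trans (le_of_eq ?_)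
        ring
      have hwp : w x ^ p ≤ ‖x‖ ^ (-b - 2) * (δ ^ 2 / 2 * H x * ‖x‖ ^ δ) := by
        have g1 : H x ^ p = H x * H x ^ (p - 1) := by
          conv_rhs => rw [← Real.rpow_one_add' hH.le (by linarith)]
          ring_nf
        calc w x ^ p ≤ (H x * ‖x‖ ^ (-b)) ^ p := Real.rpow_le_rpow hw.le hwle (by linarith)
          _ = H x * H x ^ (p - 1) * ‖x‖ ^ (-b * p) := by
            rw [Real.mul_rpow hH.le (Real.rpow_nonneg hρ.le _), ← Real.rpow_mul hρ.le, g1]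
          _ ≤ H x * (2 * ‖x‖) ^ (p - 1) * ‖x‖ ^ (-b * p) := by
            have := Real.rpow_le_rpow hH.le hH2 (show 0 ≤ p - 1 by linarith)
            gcongr
          _ = H x * (2 ^ (p - 1) * ‖x‖ ^ (2 - δ - (b - 1) * (p - 1))) *
                (‖x‖ ^ (-b - 2) * ‖x‖ ^ δ) := by
            have g2 : ‖x‖ ^ (p - 1) * ‖x‖ ^ (-b * p) =
                ‖x‖ ^ (2 - δ - (b - 1) * (p - 1)) * (‖x‖ ^ (-b - 2) * ‖x‖ ^ δ) := by
              rw [← Real.rpow_add hρ, ← Real.rpow_add hρ, ← Real.rpow_add hρ]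
              congr 1; ring
            rw [Real.mul_rpow (by norm_num) hρ.le]
            linear_combination (H x * 2 ^ (p - 1)) * g2
          _ ≤ H x * (δ ^ 2 / 2) * (‖x‖ ^ (-b - 2) * ‖x‖ ^ δ) := by
            gcongr
          _ = _ := by ring
      have := mul_le_mul_of_nonneg_right (hwp.trans hlap) (hφ0 x)
      refine this.trans (le_of_eq ?_)
      simp only [Pi.sub_apply, Pi.neg_apply]
      ring
end
end
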